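/- arXiv:2201.12957 — 4 statements merged into one kernel-verified Lean document; each statement's English description precedes it below -/
import Mathlib

section
/- Let N ≥ 3 be an integer, a > 0, β = √(1 + 4a/(N−2)²), c = (N−2)(1−β)/2, and let W_a, ΛW_a, Λ₀ΛW_a be as defined (radial profiles). Then there exists a constant C = C(N, a) such that for all r > 0: (i) |Λ₀ΛW_a(r)| + |ΛW_a(r)| + |W_a(r)| ≤ C·min{ r^{(β−1)N/2 − β + 1}, r^{−(β+1)N/2 + β + 1} }; (ii) |(ΛW_a)'(r) + (c/r)ΛW_a(r)| + |W_a'(r) + (c/r)W_a(r)| ≤ C·min{ r^{(β−1)N/2 − β}, r^{−(β+1)N/2 + β} }; (iii) |−(ΛW_a)''(r) − ((N−1)/r)(ΛW_a)'(r) + (a/r²)ΛW_a(r)| ≤ C·min{ r^{(β−1)N/2 − β − 1}, r^{−(β+1)N/2 + β − 1} }. -/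
open Polynomial in
/-- `f` is `M` times a polynomial in `θ` on the positive half line. -/
def GoodFn (M θ : ℝ → ℝ) (f : ℝ → ℝ) : Prop :=
  ∃ P : ℝ[X], ∀ r : ℝ, 0 < r → f r = M r * P.eval (θ r)

theorem GoodFn.add {M θ f g : ℝ → ℝ} (hf : GoodFn M θ f) (hg : GoodFn M θ g) :
    GoodFn M θ (fun r => f r + g r) := by
  obtain ⟨P, hP⟩ := hf
  obtain ⟨Q, hQ⟩ := hg
  refine ⟨P + Q, fun r hr => ?_⟩
  simp only [hP r hr, hQ r hr, Polynomial.eval_add]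
  ring

theorem GoodFn.smul {M θ f : ℝ → ℝ} (k : ℝ) (hf : GoodFn M θ f) :
    GoodFn M θ (fun r => k * f r) := by
  obtain ⟨P, hP⟩ := hf
  refine ⟨Polynomial.C k * P, fun r hr => ?_⟩
  simp only [hP r hr, Polynomial.eval_mul, Polynomial.eval_C]
  ring

theorem GoodFn.bound {M θ f : ℝ → ℝ} (hM : ∀ r, 0 < r → 0 ≤ M r)
    (hθ : ∀ r, 0 < r → θ r ∈ Set.Icc (0 : ℝ) 1) (hf : GoodFn M θ f) :
    ∃ C : ℝ, 0 < C ∧ ∀ r : ℝ, 0 < r → |f r| ≤ C * M r := by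
  obtain ⟨P, hP⟩ := hf
  obtain ⟨C, hC⟩ := (isCompact_Icc (a := (0 : ℝ)) (b := 1)).exists_bound_of_continuousOn
    (P.continuous.continuousOn)
  refine ⟨max C 1, by positivity, fun r hr => ?_⟩
  rw [hP r hr, abs_mul, abs_of_nonneg (hM r hr), mul_comm]
  have h1 := hC _ (hθ r hr)
  rw [Real.norm_eq_abs] at h1
  exact mul_le_mul_of_nonneg_right (h1.trans (le_max_left _ _)) (hM r hr)

theorem GoodFn.deriv_aux {M θ f : ℝ → ℝ} (p q b : ℝ)
    (hM : ∀ r, 0 < r → HasDerivAt M (M r * (p - q * θ r) / r) r)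
    (hθ : ∀ r, 0 < r → HasDerivAt θ (b * θ r * (1 - θ r) / r) r)
    (hf : GoodFn M θ f) :
    GoodFn M θ (fun r => r * deriv f r) ∧ ∀ r, 0 < r → DifferentiableAt ℝ f r := by
  obtain ⟨P, hP⟩ := hf
  have key : ∀ r, 0 < r → HasDerivAt f
      (M r * (p - q * θ r) / r * P.eval (θ r) +
        M r * (P.derivative.eval (θ r) * (b * θ r * (1 - θ r) / r))) r := by
    intro r hr
    have h := (hM r hr).mul ((P.hasDerivAt (θ r)).comp r (hθ r hr))
    refine h.congr_of_eventuallyEq ?_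
    filter_upwards [lt_mem_nhds hr] with s hs
    exact hP s hs
  refine ⟨⟨(Polynomial.C p - Polynomial.C q * Polynomial.X) * P +
    P.derivative * (Polynomial.C b * Polynomial.X * (1 - Polynomial.X)), fun r hr => ?_⟩,
    fun r hr => (key r hr).differentiableAt⟩
  simp only [(key r hr).deriv, Polynomial.eval_mul, Polynomial.eval_add, Polynomial.eval_sub,
    Polynomial.eval_C, Polynomial.eval_X, Polynomial.eval_one]
  field_simp

/-- Second derivatives. -/
theorem GoodFn.deriv_two {M θ f : ℝ → ℝ} (p q b : ℝ)
    (hM : ∀ r, 0 < r → HasDerivAt M (M r * (p - q * θ r) / r) r)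
    (hθ : ∀ r, 0 < r → HasDerivAt θ (b * θ r * (1 - θ r) / r) r)
    (hf : GoodFn M θ f) :
    GoodFn M θ (fun r => r ^ 2 * deriv (deriv f) r) := by
  have h1 := (hf.deriv_aux p q b hM hθ).1
  obtain ⟨h2, h3⟩ := h1.deriv_aux p q b hM hθ
  obtain ⟨P, hP⟩ := h2.add (h1.smul (-1))
  refine ⟨P, fun r hr => ?_⟩
  rw [← hP r hr]
  have h4 : DifferentiableAt ℝ (deriv f) r := by
    have : DifferentiableAt ℝ (fun s => (s * deriv f s) / s) r :=
      (h3 r hr).div differentiableAt_id hr.ne'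
    refine this.congr_of_eventuallyEq ?_
    filter_upwards [lt_mem_nhds hr] with s hs
    field_simp
  have h5 : HasDerivAt (fun s => s * deriv f s) (1 * deriv f r + r * deriv (deriv f) r) r :=
    (hasDerivAt_id r).mul h4.hasDerivAt
  simp only [h5.deriv]
  ring

/-- Pointwise bounds for the ground state `W_a`, for `ΛW_a` and `Λ₀ΛW_a`, for
their `A`-derivatives, and for `𝓛_a (ΛW_a)` (radial profiles). -/
theorem ground_state_pointwise_bounds
    (N : ℕ) (hN : 3 ≤ N) (a : ℝ) (ha : 0 < a)
    (β c : ℝ) (hβ : β = Real.sqrt (1 + 4 * a / ((N : ℝ) - 2) ^ 2))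
    (hc : c = ((N : ℝ) - 2) * (1 - β) / 2)
    (W ΛW Λ₀ΛW : ℝ → ℝ)
    (hW : ∀ r : ℝ, W r =
      ((N : ℝ) * ((N : ℝ) - 2) * β ^ 2) ^ (((N : ℝ) - 2) / 4) *
        (r ^ (β - 1) / (1 + r ^ (2 * β))) ^ (((N : ℝ) - 2) / 2))
    (hΛW : ∀ r : ℝ, ΛW r = ((N : ℝ) - 2) / 2 * W r + r * deriv W r)
    (hΛ₀ΛW : ∀ r : ℝ, Λ₀ΛW r = (N : ℝ) / 2 * ΛW r + r * deriv ΛW r) :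
    ∃ C : ℝ, 0 < C ∧ ∀ r : ℝ, 0 < r →
      (|Λ₀ΛW r| + |ΛW r| + |W r|
          ≤ C * min (r ^ ((β - 1) * (N : ℝ) / 2 - β + 1))
              (r ^ (-((β + 1) * (N : ℝ)) / 2 + β + 1))) ∧
      (|deriv ΛW r + (c / r) * ΛW r| + |deriv W r + (c / r) * W r|
          ≤ C * min (r ^ ((β - 1) * (N : ℝ) / 2 - β))
              (r ^ (-((β + 1) * (N : ℝ)) / 2 + β))) ∧
      (|-(deriv (deriv ΛW) r) - (((N : ℝ) - 1) / r) * deriv ΛW r + (a / r ^ 2) * ΛW r|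
          ≤ C * min (r ^ ((β - 1) * (N : ℝ) / 2 - β - 1))
              (r ^ (-((β + 1) * (N : ℝ)) / 2 + β - 1))) := by
  have hN' : (3 : ℝ) ≤ N := by exact_mod_cast hN
  have hβ0 : 0 < β := by
    rw [hβ]; apply Real.sqrt_pos.mpr; positivity
  clear hβ
  obtain ⟨m, hm⟩ : ∃ m : ℝ, m = ((N : ℝ) - 2) / 2 := ⟨_, rfl⟩
  have hm0 : 0 < m := by rw [hm]; linarith
  set K : ℝ := ((N : ℝ) * ((N : ℝ) - 2) * β ^ 2) ^ (((N : ℝ) - 2) / 4) with hK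
  set M : ℝ → ℝ := fun r => r ^ ((β - 1) * m) * (1 + r ^ (2 * β)) ^ (-m) with hMdef
  set θ : ℝ → ℝ := fun r => r ^ (2 * β) / (1 + r ^ (2 * β)) with hθdef
  have hM0 : ∀ r, 0 < r → 0 ≤ M r := fun r hr => by simp only [hMdef]; positivity
  have hθ0 : ∀ r, 0 < r → θ r ∈ Set.Icc (0 : ℝ) 1 := fun r hr => by
    simp only [hθdef]
    have : 0 < r ^ (2 * β) := by positivity
    constructor
    · positivity
    · rw [div_le_one (by positivity)]; linarith
  have hpow : ∀ r e : ℝ, 0 < r → HasDerivAt (fun s : ℝ => s ^ e) (e * r ^ e / r) r := by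
    intro r e hr
    have := Real.hasDerivAt_rpow_const (x := r) (p := e) (Or.inl hr.ne')
    rwa [Real.rpow_sub_one hr.ne', ← mul_div_assoc] at this
  have hMd : ∀ r, 0 < r → HasDerivAt M (M r * ((β - 1) * m - (2 * β * m) * θ r) / r) r := by
    intro r hr
    have hD : 0 < 1 + r ^ (2 * β) := by positivity
    have h1 := ((hpow r (2 * β) hr).const_add 1)
    have h2 := (hpow (1 + r ^ (2 * β)) (-m) hD).comp r h1
    have h3 := (hpow r ((β - 1) * m) hr).mul h2
    refine h3.congr_deriv ?_
    simp only [hMdef, hθdef, Function.comp]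
    field_simp
    ring
  have hθd : ∀ r, 0 < r → HasDerivAt θ ((2 * β) * θ r * (1 - θ r) / r) r := by
    intro r hr
    have hD : 0 < 1 + r ^ (2 * β) := by positivity
    have h1 := (hpow r (2 * β) hr)
    have h3 := h1.div (h1.const_add 1) hD.ne'
    refine h3.congr_deriv ?_
    simp only [hθdef]
    field_simp
  have gW : GoodFn M θ W := by
    refine ⟨Polynomial.C K, fun r hr => ?_⟩
    have hD : 0 < 1 + r ^ (2 * β) := by positivity
    rw [hW r, Polynomial.eval_C, ← hm, Real.div_rpow (by positivity) hD.le,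
      ← Real.rpow_mul hr.le]
    simp only [hMdef]
    rw [Real.rpow_neg hD.le]
    ring
  have gdW := (gW.deriv_aux _ _ _ hMd hθd).1
  have gL : GoodFn M θ ΛW := by
    have := (gW.smul (((N : ℝ) - 2) / 2)).add gdW
    rwa [← funext hΛW] at this
  have gdL := (gL.deriv_aux _ _ _ hMd hθd).1
  have gddL := gL.deriv_two _ _ _ hMd hθd
  have gLL : GoodFn M θ Λ₀ΛW := by
    have := (gL.smul ((N : ℝ) / 2)).add gdL
    rwa [← funext hΛ₀ΛW] at this
  obtain ⟨C1, hC1, b1⟩ := gLL.bound hM0 hθ0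
  obtain ⟨C2, hC2, b2⟩ := gL.bound hM0 hθ0
  obtain ⟨C3, hC3, b3⟩ := gW.bound hM0 hθ0
  obtain ⟨C4, hC4, b4⟩ := (gdL.add (gL.smul c)).bound hM0 hθ0
  obtain ⟨C5, hC5, b5⟩ := (gdW.add (gW.smul c)).bound hM0 hθ0
  obtain ⟨C6, hC6, b6⟩ := (((gddL.smul (-1)).add (gdL.smul (-((N : ℝ) - 1)))).add
    (gL.smul a)).bound hM0 hθ0
  refine ⟨C1 + C2 + C3 + C4 + C5 + C6, by positivity, fun r hr => ?_⟩
  have hNm : (N : ℝ) = 2 * m + 2 := by rw [hm]; ring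
  have hD : 0 < 1 + r ^ (2 * β) := by positivity
  have hx : 0 < r ^ (2 * β) := by positivity
  have m1 : M r ≤ r ^ ((β - 1) * m) := by
    simp only [hMdef]
    refine mul_le_of_le_one_right (by positivity) ?_
    exact Real.rpow_le_one_of_one_le_of_nonpos (by linarith) (by linarith)
  have m2 : M r ≤ r ^ (-(β + 1) * m) := by
    have h1 : (1 + r ^ (2 * β)) ^ (-m) ≤ (r ^ (2 * β)) ^ (-m) :=
      Real.rpow_le_rpow_of_nonpos hx (by linarith) (by linarith)
    have h2 : r ^ (-(β + 1) * m) = r ^ ((β - 1) * m) * (r ^ (2 * β)) ^ (-m) := by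
      rw [← Real.rpow_mul hr.le, ← Real.rpow_add hr]; congr 1; ring
    rw [h2]
    exact mul_le_mul_of_nonneg_left h1 (by positivity)
  have hMr := hM0 r hr
  -- general comparison
  have fin : ∀ (X D : ℝ) (j e1 e2 : ℝ), D ≤ C1 + C2 + C3 + C4 + C5 + C6 →
      X ≤ D * M r * r ^ j → e1 = (β - 1) * m + j →
      e2 = -(β + 1) * m + j → X ≤ (C1 + C2 + C3 + C4 + C5 + C6) * min (r ^ e1) (r ^ e2) := by
    intro X D j e1 e2 hDC hX he1 he2
    have hj : 0 < r ^ j := by positivity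
    rw [he1, he2, Real.rpow_add hr, Real.rpow_add hr]
    have hle : M r * r ^ j ≤ min (r ^ ((β - 1) * m) * r ^ j) (r ^ (-(β + 1) * m) * r ^ j) :=
      le_min (mul_le_mul_of_nonneg_right m1 hj.le) (mul_le_mul_of_nonneg_right m2 hj.le)
    calc X ≤ D * (M r * r ^ j) := by rw [← mul_assoc]; exact hX
      _ ≤ (C1 + C2 + C3 + C4 + C5 + C6) * (M r * r ^ j) :=
        mul_le_mul_of_nonneg_right hDC (by positivity)
      _ ≤ _ := mul_le_mul_of_nonneg_left hle (by positivity)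
  refine ⟨?_, ?_, ?_⟩
  · refine fin _ (C1 + C2 + C3) 0 _ _ (by linarith) ?_ (by rw [hNm]; ring) (by rw [hNm]; ring)
    rw [Real.rpow_zero]
    linarith [b1 r hr, b2 r hr, b3 r hr]
  · refine fin _ (C4 + C5) (-1) _ _ (by linarith) ?_ (by rw [hNm]; ring) (by rw [hNm]; ring)
    have e1 : deriv ΛW r + c / r * ΛW r = (r * deriv ΛW r + c * ΛW r) * r⁻¹ := by
      field_simp
    have e2 : deriv W r + c / r * W r = (r * deriv W r + c * W r) * r⁻¹ := by
      field_simp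
    have hi : 0 < r⁻¹ := by positivity
    rw [Real.rpow_neg_one, e1, e2, abs_mul, abs_mul, abs_of_pos hi, ← add_mul]
    refine mul_le_mul_of_nonneg_right ?_ hi.le
    linarith [b4 r hr, b5 r hr]
  · refine fin _ C6 (-2) _ _ (by linarith) ?_ (by rw [hNm]; ring) (by rw [hNm]; ring)
    have e1 : -(deriv (deriv ΛW) r) - (((N : ℝ) - 1) / r) * deriv ΛW r + (a / r ^ 2) * ΛW r
        = (-1 * (r ^ 2 * deriv (deriv ΛW) r) + -((N : ℝ) - 1) * (r * deriv ΛW r)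
          + a * ΛW r) * (r ^ 2)⁻¹ := by
      field_simp
      ring
    have hi : 0 < (r ^ 2)⁻¹ := by positivity
    have e2 : r ^ (-2 : ℝ) = (r ^ 2)⁻¹ := by
      rw [Real.rpow_neg hr.le]; norm_num
    rw [e1, e2, abs_mul, abs_of_pos hi]
    exact mul_le_mul_of_nonneg_right (b6 r hr) hi.le
end

section
/- Let N ≥ 3 be an integer, a > 0, β = √(1 + 4a/(N−2)²), c = (N−2)(1−β)/2, and assume (N−2)β ≥ 2. Then there exists a constant C = C(N, a) such that for all 0 < λ < μ: ∫₀^∞ |((ΛW_a)_{(λ)})'(r) + (c/r)(ΛW_a)_{(λ)}(r)| · |((ΛW_a)_{(μ)})'(r) + (c/r)(ΛW_a)_{(μ)}(r)| r^{N−1}dr + ∫₀^∞ |(W_{a(λ)})'(r) + (c/r)W_{a(λ)}(r)| · |(W_{a(μ)})'(r) + (c/r)W_{a(μ)}(r)| r^{N−1}dr ≤ C (λ/μ)^{(N−2)β/2}, and ∫_{ℝ^N} |(ΛW_a)_{[λ]}(x) (ΛW_a)_{[μ]}(x)| dx + ∫_{ℝ^N} |(ΛW_a)_{[λ]}(x)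 (Λ₀ΛW_a)_{[μ]}(x)| dx ≤ C (λ/μ)^{(N−2)β/2 − 1}. -/
open MeasureTheory

/-- Basic profile `r^e (1+r^{2β})^{-q}`. -/
noncomputable def phi (β e q r : ℝ) : ℝ := r ^ e * (1 + r ^ (2 * β)) ^ (-q)

lemma phi_pos (β e q : ℝ) {r : ℝ} (hr : 0 < r) : 0 < phi β e q r := by
  unfold phi; positivity

lemma phi_mul (β e q u : ℝ) {r : ℝ} (hr : 0 < r) : r ^ u * phi β e q r = phi β (u + e) q r := by
  unfold phi; rw [Real.rpow_add hr]; ring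

lemma phi_succ (β e q : ℝ) {r : ℝ} (hr : 0 < r) :
    phi β (e + 2 * β) (q + 1) r = phi β e q r - phi β e (q + 1) r := by
  unfold phi
  have h : 0 < 1 + r ^ (2 * β) := by positivity
  have : (1 + r ^ (2 * β)) ^ (-q) = (1 + r ^ (2 * β)) ^ (-(q + 1)) * (1 + r ^ (2 * β)) := by
    rw [← Real.rpow_add_one h.ne']; congr 1; ring
  rw [this, Real.rpow_add hr]; ring

lemma phi_anti (β e : ℝ) {q q' : ℝ} (h : q ≤ q') {r : ℝ} (hr : 0 < r) :
    phi β e q' r ≤ phi β e q r := by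
  unfold phi
  have h1 : 1 ≤ 1 + r ^ (2 * β) := by
    have : 0 < r ^ (2 * β) := by positivity
    linarith
  gcongr

lemma phi_le (β e : ℝ) {q : ℝ} (hq : 0 ≤ q) {r : ℝ} (hr : 0 < r) :
    phi β e q r ≤ r ^ (e - 2 * β * q) := by
  unfold phi
  have h0 : 0 < r ^ (2 * β) := by positivity
  rw [sub_eq_add_neg, Real.rpow_add hr, ← mul_neg, Real.rpow_mul hr.le (2 * β)]
  have := Real.rpow_le_rpow_of_nonpos h0 (y := 1 + r ^ (2 * β)) (by linarith) (neg_nonpos.mpr hq)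
  gcongr

lemma phi_le_zero (β e : ℝ) {q : ℝ} (hq : 0 ≤ q) {r : ℝ} (hr : 0 < r) :
    phi β e q r ≤ r ^ e := by
  have := phi_anti β e hq hr
  simpa [phi] using this

lemma phi_hasDerivAt (β e q : ℝ) {r : ℝ} (hr : 0 < r) :
    HasDerivAt (phi β e q)
      (((e - 2 * β * q) * phi β e q r + 2 * β * q * phi β e (q + 1) r) / r) r := by
  have h : 0 < 1 + r ^ (2 * β) := by positivity
  have h1 : HasDerivAt (fun x : ℝ => x ^ e) (e * r ^ (e - 1)) r :=
    Real.hasDerivAt_rpow_const (Or.inl hr.ne')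
  have h2 : HasDerivAt (fun x : ℝ => x ^ (2 * β)) (2 * β * r ^ (2 * β - 1)) r :=
    Real.hasDerivAt_rpow_const (Or.inl hr.ne')
  have h3 := (h2.const_add 1).rpow_const (p := -q) (Or.inl h.ne')
  have h4 := h1.mul h3
  refine h4.congr_deriv ?_
  have e1 : r ^ (e - 1) = r ^ e / r := Real.rpow_sub_one hr.ne' e
  have e2 : r ^ (2 * β - 1) = r ^ (2 * β) / r := Real.rpow_sub_one hr.ne' _
  have e3 : (1 + r ^ (2 * β)) ^ (-q) = (1 + r ^ (2 * β)) ^ (-(q + 1)) * (1 + r ^ (2 * β)) := by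
    rw [← Real.rpow_add_one h.ne']; congr 1; ring
  have e4 : (-q - 1) = -(q + 1) := by ring
  unfold phi
  rw [e1, e2, e4, e3]
  field_simp
  ring

lemma phi_integrable {β e q : ℝ} (he : -1 < e) (hq : 0 ≤ q) (h : e - 2 * β * q < -1) :
    IntegrableOn (phi β e q) (Set.Ioi 0) := by
  have hm : Measurable (phi β e q) := by unfold phi; fun_prop
  rw [← Set.Ioc_union_Ioi_eq_Ioi zero_le_one]
  refine IntegrableOn.union ?_ ?_
  · have : IntegrableOn (fun t : ℝ => t ^ e) (Set.Ioc 0 1) :=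
      (intervalIntegrable_iff_integrableOn_Ioc_of_le zero_le_one).mp
        (intervalIntegral.intervalIntegrable_rpow' he)
    refine this.mono' hm.aestronglyMeasurable ?_
    refine (ae_restrict_iff' measurableSet_Ioc).mpr (Filter.Eventually.of_forall fun r hr => ?_)
    rw [Real.norm_of_nonneg (phi_pos _ _ _ hr.1).le]
    exact phi_le_zero _ _ hq hr.1
  · refine (integrableOn_Ioi_rpow_of_lt h zero_lt_one).mono' hm.aestronglyMeasurable ?_
    refine (ae_restrict_iff' measurableSet_Ioi).mpr (Filter.Eventually.of_forall fun r hr => ?_)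
    have hr0 : 0 < r := lt_trans zero_lt_one hr
    rw [Real.norm_of_nonneg (phi_pos _ _ _ hr0).le]
    exact phi_le _ _ hq hr0

/-- Generic interaction bound. -/
lemma interaction_bound {β e q p κ M M' lam mu : ℝ} (F1 F2 f : ℝ → ℝ)
    (hM : 0 ≤ M) (hM' : 0 ≤ M')
    (h1 : ∀ t, 0 < t → |F1 t| ≤ M * t ^ (-p - 1 - κ))
    (h2 : ∀ t, 0 < t → |F2 t| ≤ M' * phi β e q t)
    (he : -1 < p - κ + e) (hq : 0 ≤ q) (heq : p - κ + e - 2 * β * q < -1)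
    (hl : 0 < lam) (hm : 0 < mu)
    (hf0 : ∀ r, 0 < r → 0 ≤ f r)
    (hf : ∀ r, 0 < r → f r ≤ (lam ^ (-p - 1) * |F1 (r / lam)|) *
      (mu ^ (-p - 1) * |F2 (r / mu)|) * r ^ (2 * p + 1)) :
    ∫ r in Set.Ioi (0 : ℝ), f r ≤
      (M * M' * ∫ t in Set.Ioi (0 : ℝ), phi β (p - κ + e) q t) * (lam / mu) ^ κ := by
  have hint : IntegrableOn (phi β (p - κ + e) q) (Set.Ioi 0) := phi_integrable he hq heq
  have hint2 : IntegrableOn (fun r => phi β (p - κ + e) q (mu⁻¹ * r)) (Set.Ioi 0) := by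
    rw [integrableOn_Ioi_comp_mul_left_iff _ _ (inv_pos.mpr hm)]; simpa using hint
  have hI : ∫ r in Set.Ioi (0 : ℝ), phi β (p - κ + e) q (mu⁻¹ * r) =
      mu * ∫ t in Set.Ioi (0 : ℝ), phi β (p - κ + e) q t := by
    rw [integral_comp_mul_left_Ioi _ _ (inv_pos.mpr hm)]; simp
  calc ∫ r in Set.Ioi (0 : ℝ), f r
      ≤ ∫ r in Set.Ioi (0 : ℝ), (M * M' * (lam / mu) ^ κ * mu⁻¹) *
          phi β (p - κ + e) q (mu⁻¹ * r) := by
        refine integral_mono_of_nonneg ?_ (hint2.const_mul _) ?_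
        · exact (ae_restrict_iff' measurableSet_Ioi).mpr (Filter.Eventually.of_forall hf0)
        · refine (ae_restrict_iff' measurableSet_Ioi).mpr (Filter.Eventually.of_forall ?_)
          intro r hr
          have hr : 0 < r := hr
          refine (hf r hr).trans ?_
          have ht : 0 < mu⁻¹ * r := by positivity
          have a1 := h1 (r / lam) (by positivity)
          have a2 := h2 (r / mu) (by positivity)
          have a2' : |F2 (r / mu)| ≤ M' * phi β e q (mu⁻¹ * r) := by
            rw [show mu⁻¹ * r = r / mu by field_simp]; exact a2
          calc _ ≤ (lam ^ (-p - 1) * (M * (r / lam) ^ (-p - 1 - κ))) *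
              (mu ^ (-p - 1) * (M' * phi β e q (mu⁻¹ * r))) * r ^ (2 * p + 1) := by gcongr
            _ = (M * M' * (lam / mu) ^ κ * mu⁻¹) * phi β (p - κ + e) q (mu⁻¹ * r) := by
              rw [← phi_mul β e q (p - κ) ht]
              have key : lam ^ (-p - 1) * (r / lam) ^ (-p - 1 - κ) * mu ^ (-p - 1) *
                  r ^ (2 * p + 1) = (lam / mu) ^ κ * mu⁻¹ * (mu⁻¹ * r) ^ (p - κ) := by
                rw [show lam = Real.exp (Real.log lam) from (Real.exp_log hl).symm,
                  show mu = Real.exp (Real.log mu) from (Real.exp_log hm).symm,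
                  show r = Real.exp (Real.log r) from (Real.exp_log hr).symm]
                simp only [← Real.exp_neg, ← Real.exp_sub, ← Real.exp_add, ← Real.exp_mul]
                congr 1
                ring
              linear_combination (M * M' * phi β e q (mu⁻¹ * r)) * key
    _ = _ := by
        rw [integral_const_mul, hI]; field_simp

/-- Non-integrability at the endpoint. -/
lemma not_integrable_aux {f : ℝ → ℝ} {δ R : ℝ} (hδ : 0 < δ) (hR : 0 < R)
    (h : ∀ r, R < r → δ * r⁻¹ ≤ f r) : ¬ IntegrableOn f (Set.Ioi 0) := by
  intro hf
  have hf1 : IntegrableOn (fun r => δ⁻¹ * f r) (Set.Ioi R) :=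
    (hf.mono_set (Set.Ioi_subset_Ioi hR.le)).const_mul _
  refine not_integrableOn_Ioi_inv (a := R) (hf1.mono' measurable_inv.aestronglyMeasurable ?_)
  refine (ae_restrict_iff' measurableSet_Ioi).mpr (Filter.Eventually.of_forall fun r hr => ?_)
  have hr0 : 0 < r := hR.trans hr
  rw [Real.norm_of_nonneg (by positivity)]
  have := h r hr
  rw [inv_mul_eq_div, le_div_iff₀ hδ]
  linarith

/-- Radial integrals. -/
lemma radial_integral {N : ℕ} (hN : 3 ≤ N) (f : ℝ → ℝ) :
    ∫ x : EuclideanSpace ℝ (Fin N), f ‖x‖ =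
      (N * volume.real (Metric.ball (0 : EuclideanSpace ℝ (Fin N)) 1)) *
        ∫ r in Set.Ioi (0 : ℝ), r ^ ((N : ℝ) - 1) * f r := by
  have : Nonempty (Fin N) := ⟨⟨0, by omega⟩⟩
  rw [integral_fun_norm_addHaar]
  simp only [finrank_euclideanSpace, Fintype.card_fin, smul_eq_mul, nsmul_eq_mul]
  rw [mul_assoc]
  congr 2
  refine setIntegral_congr_fun measurableSet_Ioi fun r _ => ?_
  have : ((N : ℝ) - 1) = ((N - 1 : ℕ) : ℝ) := by push_cast [Nat.cast_sub (by omega : 1 ≤ N)]; ring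
  simp only [this, Real.rpow_natCast]

lemma deriv_scaled {F : ℝ → ℝ} {p c lam r : ℝ} (hl : 0 < lam) (hr : 0 < r) :
    deriv (fun s => lam ^ (-p) * F (s / lam)) r + (c / r) * (lam ^ (-p) * F (r / lam)) =
      lam ^ (-p - 1) * (deriv F (r / lam) + c / (r / lam) * F (r / lam)) := by
  have h : deriv (fun s => lam ^ (-p) * F (s / lam)) r = lam ^ (-p) * (deriv F (r / lam) / lam) := by
    rw [deriv_const_mul_field]
    congr 1
    have := deriv_comp_mul_left lam⁻¹ F r
    simp only [smul_eq_mul, inv_mul_eq_div] at this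
    exact this
  rw [h, Real.rpow_sub_one hl.ne']
  field_simp

/-- Cross-interaction estimates between two soliton scales: the `Ḣ¹_a`
cross-terms of `ΛW_a` and `W_a`, and the `L²` cross-terms of `ΛW_a` and
`Λ₀ΛW_a`. -/
theorem soliton_cross_interaction_estimates
    (N : ℕ) (hN : 3 ≤ N) (a : ℝ) (ha : 0 < a)
    (β c : ℝ) (hβ : β = Real.sqrt (1 + 4 * a / ((N : ℝ) - 2) ^ 2))
    (hc : c = ((N : ℝ) - 2) * (1 - β) / 2)
    (hβ2 : 2 ≤ ((N : ℝ) - 2) * β)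
    (W ΛW Λ₀ΛW : ℝ → ℝ)
    (hW : ∀ r : ℝ, W r =
      ((N : ℝ) * ((N : ℝ) - 2) * β ^ 2) ^ (((N : ℝ) - 2) / 4) *
        (r ^ (β - 1) / (1 + r ^ (2 * β))) ^ (((N : ℝ) - 2) / 2))
    (hΛW : ∀ r : ℝ, ΛW r = ((N : ℝ) - 2) / 2 * W r + r * deriv W r)
    (hΛ₀ΛW : ∀ r : ℝ, Λ₀ΛW r = (N : ℝ) / 2 * ΛW r + r * deriv ΛW r) :
    ∃ C : ℝ, 0 < C ∧ ∀ lam mu : ℝ, 0 < lam → lam < mu →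
      ((∫ r in Set.Ioi (0 : ℝ),
          |deriv (fun s => lam ^ (-(((N : ℝ) - 2) / 2)) * ΛW (s / lam)) r
              + (c / r) * (lam ^ (-(((N : ℝ) - 2) / 2)) * ΛW (r / lam))| *
            |deriv (fun s => mu ^ (-(((N : ℝ) - 2) / 2)) * ΛW (s / mu)) r
              + (c / r) * (mu ^ (-(((N : ℝ) - 2) / 2)) * ΛW (r / mu))| *
            r ^ ((N : ℝ) - 1))
        + (∫ r in Set.Ioi (0 : ℝ),
          |deriv (fun s => lam ^ (-(((N : ℝ) - 2) / 2)) * W (s / lam)) r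
              + (c / r) * (lam ^ (-(((N : ℝ) - 2) / 2)) * W (r / lam))| *
            |deriv (fun s => mu ^ (-(((N : ℝ) - 2) / 2)) * W (s / mu)) r
              + (c / r) * (mu ^ (-(((N : ℝ) - 2) / 2)) * W (r / mu))| *
            r ^ ((N : ℝ) - 1))
        ≤ C * (lam / mu) ^ (((N : ℝ) - 2) * β / 2)) ∧
      ((∫ x : EuclideanSpace ℝ (Fin N),
          |lam ^ (-((N : ℝ) / 2)) * ΛW (‖x‖ / lam) *
            (mu ^ (-((N : ℝ) / 2)) * ΛW (‖x‖ / mu))|)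
        + (∫ x : EuclideanSpace ℝ (Fin N),
          |lam ^ (-((N : ℝ) / 2)) * ΛW (‖x‖ / lam) *
            (mu ^ (-((N : ℝ) / 2)) * Λ₀ΛW (‖x‖ / mu))|)
        ≤ C * (lam / mu) ^ (((N : ℝ) - 2) * β / 2 - 1)) := by
  obtain ⟨p, hp⟩ : ∃ p : ℝ, p = ((N : ℝ) - 2) / 2 := ⟨_, rfl⟩
  have hN3 : (3 : ℝ) ≤ N := by exact_mod_cast hN
  have hNp : (N : ℝ) = 2 * p + 2 := by linarith
  have hp0 : 0 < p := by linarith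
  have hβ1 : 1 ≤ β := by
    rw [hβ, Real.one_le_sqrt]
    have : 0 ≤ 4 * a / ((N : ℝ) - 2) ^ 2 := by positivity
    linarith
  have hβ0 : 0 < β := by linarith
  obtain ⟨γ, hγ⟩ : ∃ γ : ℝ, γ = p * β := ⟨_, rfl⟩
  have hγ1 : 1 ≤ γ := by rw [hγ]; rw [hNp] at hβ2; linarith
  have hcp : c = p - γ := by rw [hc, hγ, hNp]; ring
  obtain ⟨A, hA⟩ : ∃ A : ℝ, A = ((N : ℝ) * ((N : ℝ) - 2) * β ^ 2) ^ (((N : ℝ) - 2) / 4) :=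
    ⟨_, rfl⟩
  have hA0 : 0 < A := by
    rw [hA]
    have : 0 < (N : ℝ) - 2 := by linarith
    positivity
  -- explicit formulas
  have fW : ∀ r, 0 < r → W r = A * phi β (-c) p r := by
    intro r hr
    have h1 : 0 ≤ 1 + r ^ (2 * β) := by positivity
    rw [hW, ← hA, ← hp, Real.div_rpow (by positivity) h1, ← Real.rpow_mul hr.le]
    unfold phi
    rw [Real.rpow_neg h1, div_eq_mul_inv]
    congr 3
    rw [hcp, hγ]; ring
  have dW : ∀ r, 0 < r → deriv W r =
      A * (((-c - 2 * β * p) * phi β (-c) p r + 2 * β * p * phi β (-c) (p + 1) r) / r) := by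
    intro r hr
    have h1 := (phi_hasDerivAt β (-c) p hr).const_mul A
    refine (h1.congr_of_eventuallyEq ?_).deriv
    filter_upwards [lt_mem_nhds hr] with x hx using fW x hx
  have fL : ∀ r, 0 < r → ΛW r =
      A * γ * (2 * phi β (-c) (p + 1) r - phi β (-c) p r) := by
    intro r hr
    rw [hΛW, ← hp, dW r hr, fW r hr, hcp, hγ]
    field_simp
    ring
  have dL : ∀ r, 0 < r → deriv ΛW r =
      A * γ * (2 * (((-c - 2 * β * (p + 1)) * phi β (-c) (p + 1) r +
        2 * β * (p + 1) * phi β (-c) (p + 1 + 1) r) / r) -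
        (((-c - 2 * β * p) * phi β (-c) p r + 2 * β * p * phi β (-c) (p + 1) r) / r)) := by
    intro r hr
    have h1 := (((phi_hasDerivAt β (-c) (p + 1) hr).const_mul 2).sub
      (phi_hasDerivAt β (-c) p hr)).const_mul (A * γ)
    refine (h1.congr_of_eventuallyEq ?_).deriv
    filter_upwards [lt_mem_nhds hr] with x hx using fL x hx
  have fL0 : ∀ r, 0 < r → Λ₀ΛW r = A * γ * ((γ - 1) * phi β (-c) p r +
      ((2 * (γ + 1) - 4 * β * (p + 1) - 2 * γ) * phi β (-c) (p + 1) r +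
        4 * β * (p + 1) * phi β (-c) (p + 1 + 1) r)) := by
    intro r hr
    rw [hΛ₀ΛW, dL r hr, fL r hr, hcp, hγ, hNp]
    field_simp
    ring
  -- `Ḣ¹` type bounds
  have bW : ∀ r, 0 < r → |deriv W r + c / r * W r| ≤
      (2 * γ * A) * phi β (-c - 1 + 2 * β) (p + 1) r := by
    intro r hr
    have e1 : deriv W r + c / r * W r = -((2 * γ * A) * phi β (-c - 1 + 2 * β) (p + 1) r) := by
      have e2 := phi_mul β (-c + 2 * β) (p + 1) (-1) hr
      rw [phi_succ β (-c) p hr, Real.rpow_neg_one] at e2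
      rw [show -c - 1 + 2 * β = -1 + (-c + 2 * β) by ring, ← e2, dW r hr, fW r hr, hγ]
      field_simp
      ring
    have := phi_pos β (-c - 1 + 2 * β) (p + 1) hr
    have hg : 0 < γ := by linarith
    rw [e1, abs_neg, abs_of_nonneg (by positivity)]
  have bL : ∀ r, 0 < r → |deriv ΛW r + c / r * ΛW r| ≤
      (A * γ * (4 * β * (p + 1) + 2 * γ)) * phi β (-c - 1 + 2 * β) (p + 1) r := by
    intro r hr
    have e1 : deriv ΛW r + c / r * ΛW r = A * γ *
        (2 * γ * phi β (-c - 1 + 2 * β) (p + 1) r -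
          4 * β * (p + 1) * phi β (-c - 1 + 2 * β) (p + 1 + 1) r) := by
      have e2 := phi_mul β (-c + 2 * β) (p + 1) (-1) hr
      rw [phi_succ β (-c) p hr, Real.rpow_neg_one] at e2
      have e3 := phi_mul β (-c + 2 * β) (p + 1 + 1) (-1) hr
      rw [phi_succ β (-c) (p + 1) hr, Real.rpow_neg_one] at e3
      rw [show -c - 1 + 2 * β = -1 + (-c + 2 * β) by ring, ← e2, ← e3, dL r hr, fL r hr, hγ]
      field_simp
      ring
    have q1 := phi_pos β (-c - 1 + 2 * β) (p + 1) hr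
    have q2 := phi_pos β (-c - 1 + 2 * β) (p + 1 + 1) hr
    have q3 := phi_anti β (-c - 1 + 2 * β) (show p + 1 ≤ p + 1 + 1 by linarith) hr
    have hg : 0 < γ := by linarith
    rw [e1, abs_mul, abs_of_nonneg (by positivity : 0 ≤ A * γ), mul_assoc (A * γ)]
    refine mul_le_mul_of_nonneg_left ?_ (by positivity)
    have hb : 0 < 4 * β * (p + 1) := by positivity
    have q4 := mul_le_mul_of_nonneg_left q3 hb.le
    have q5 := mul_pos hb q2
    have q6 := mul_pos hg q1
    rw [abs_le]
    constructor <;> nlinarith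
  have toPow : ∀ (F : ℝ → ℝ) (M : ℝ), 0 ≤ M →
      (∀ r, 0 < r → |F r| ≤ M * phi β (-c - 1 + 2 * β) (p + 1) r) →
      ∀ r, 0 < r → |F r| ≤ M * r ^ (-p - 1 - γ) := by
    intro F M hM h r hr
    refine (h r hr).trans (mul_le_mul_of_nonneg_left ?_ hM)
    refine (phi_le β _ (by linarith) hr).trans_eq ?_
    congr 1
    rw [hcp, hγ]; ring
  -- `L²` type bounds
  have bL2 : ∀ r, 0 < r → |ΛW r| ≤ (A * γ) * phi β (-c) p r := by
    intro r hr
    have q1 := phi_pos β (-c) p hr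
    have q2 := phi_pos β (-c) (p + 1) hr
    have q3 := phi_anti β (-c) (show p ≤ p + 1 by linarith) hr
    have hg : 0 < γ := by linarith
    rw [fL r hr, abs_mul, abs_of_nonneg (by positivity : 0 ≤ A * γ)]
    refine mul_le_mul_of_nonneg_left ?_ (by positivity)
    rw [abs_le]
    constructor <;> linarith
  have bL2' : ∀ r, 0 < r → |ΛW r| ≤ (A * γ) * r ^ (-p - 1 - (γ - 1)) := by
    intro r hr
    have hg : 0 < γ := by linarith
    refine (bL2 r hr).trans (mul_le_mul_of_nonneg_left ?_ (by positivity))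
    refine (phi_le β _ hp0.le hr).trans_eq ?_
    congr 1
    rw [hcp, hγ]; ring
  have bL0 : ∃ M q : ℝ, 0 ≤ M ∧ 0 ≤ q ∧ 2 < 2 * β * q ∧
      ∀ r, 0 < r → |Λ₀ΛW r| ≤ M * phi β (-c) q r := by
    have hg : 0 < γ := by linarith
    obtain ⟨K, hK⟩ : ∃ K : ℝ, K = |2 * (γ + 1) - 4 * β * (p + 1) - 2 * γ| + 4 * β * (p + 1) :=
      ⟨_, rfl⟩
    have hK0 : 0 ≤ K := by rw [hK]; positivity
    have key : ∀ r, 0 < r → |(2 * (γ + 1) - 4 * β * (p + 1) - 2 * γ) * phi β (-c) (p + 1) r +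
        4 * β * (p + 1) * phi β (-c) (p + 1 + 1) r| ≤ K * phi β (-c) (p + 1) r := by
      intro r hr
      have q1 := phi_pos β (-c) (p + 1) hr
      have q2 := phi_pos β (-c) (p + 1 + 1) hr
      have q3 := phi_anti β (-c) (show p + 1 ≤ p + 1 + 1 by linarith) hr
      refine (abs_add_le _ _).trans ?_
      rw [abs_mul, abs_of_pos q1, abs_of_pos (by positivity :
        0 < 4 * β * (p + 1) * phi β (-c) (p + 1 + 1) r), hK, add_mul]
      gcongr
    rcases hγ1.eq_or_lt with h | h
    · refine ⟨A * γ * K, p + 1, by positivity, by positivity, ?_, ?_⟩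
      · nlinarith
      · intro r hr
        rw [fL0 r hr, abs_mul, abs_of_nonneg (by positivity : 0 ≤ A * γ), mul_assoc (A * γ), ← h]
        refine mul_le_mul_of_nonneg_left ?_ (by positivity)
        have := key r hr
        rw [← h] at this
        simpa using this
    · refine ⟨A * γ * (γ - 1 + K), p, ?_, hp0.le, by nlinarith, ?_⟩
      · have : 0 < γ - 1 := by linarith
        positivity
      · intro r hr
        rw [fL0 r hr, abs_mul, abs_of_nonneg (by positivity : 0 ≤ A * γ), mul_assoc (A * γ)]
        refine mul_le_mul_of_nonneg_left ?_ (by positivity)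
        refine (abs_add_le _ _).trans ?_
        have q1 := phi_pos β (-c) p hr
        have q3 := phi_anti β (-c) (show p ≤ p + 1 by linarith) hr
        rw [abs_of_nonneg (mul_nonneg (by linarith) q1.le), add_mul]
        have := key r hr
        have := mul_le_mul_of_nonneg_left q3 hK0
        linarith
  obtain ⟨M0, q0, hM0, hq0, hβq0, bL0⟩ := bL0
  have hg : 0 < γ := by linarith
  have hγβ : 2 * β * (p + 1) = 2 * γ + 2 * β := by rw [hγ]; ring
  -- the four constants
  obtain ⟨V, hV⟩ : ∃ V : ℝ,
    V = N * volume.real (Metric.ball (0 : EuclideanSpace ℝ (Fin N)) 1) := ⟨_, rfl⟩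
  have hV0 : 0 ≤ V := by rw [hV]; positivity
  obtain ⟨C1, H1⟩ : ∃ C1 : ℝ, ∀ lam mu : ℝ, 0 < lam → lam < mu →
      (∫ r in Set.Ioi (0 : ℝ),
          |deriv (fun s => lam ^ (-(((N : ℝ) - 2) / 2)) * ΛW (s / lam)) r
              + (c / r) * (lam ^ (-(((N : ℝ) - 2) / 2)) * ΛW (r / lam))| *
            |deriv (fun s => mu ^ (-(((N : ℝ) - 2) / 2)) * ΛW (s / mu)) r
              + (c / r) * (mu ^ (-(((N : ℝ) - 2) / 2)) * ΛW (r / mu))| *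
            r ^ ((N : ℝ) - 1)) ≤ C1 * (lam / mu) ^ γ := by
    have hM : 0 ≤ A * γ * (4 * β * (p + 1) + 2 * γ) := by positivity
    refine ⟨_, fun lam mu hl hlm => interaction_bound (p := p) (κ := γ)
      (fun r => deriv ΛW r + c / r * ΛW r) (fun r => deriv ΛW r + c / r * ΛW r) _ hM hM
      (toPow _ _ hM bL) bL ?_ ?_ ?_ hl (hl.trans hlm) ?_ ?_⟩
    · linarith
    · linarith
    · linarith
    · intro r hr; positivity
    · intro r hr
      rw [← hp, deriv_scaled hl hr, deriv_scaled (hl.trans hlm) hr, abs_mul, abs_mul,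
        abs_of_pos (by positivity : 0 < lam ^ (-p - 1)),
        abs_of_pos (Real.rpow_pos_of_pos (hl.trans hlm) (-p - 1)),
        show (N : ℝ) - 1 = 2 * p + 1 by linarith]
  obtain ⟨C2, H2⟩ : ∃ C2 : ℝ, ∀ lam mu : ℝ, 0 < lam → lam < mu →
      (∫ r in Set.Ioi (0 : ℝ),
          |deriv (fun s => lam ^ (-(((N : ℝ) - 2) / 2)) * W (s / lam)) r
              + (c / r) * (lam ^ (-(((N : ℝ) - 2) / 2)) * W (r / lam))| *
            |deriv (fun s => mu ^ (-(((N : ℝ) - 2) / 2)) * W (s / mu)) r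
              + (c / r) * (mu ^ (-(((N : ℝ) - 2) / 2)) * W (r / mu))| *
            r ^ ((N : ℝ) - 1)) ≤ C2 * (lam / mu) ^ γ := by
    have hM : 0 ≤ 2 * γ * A := by positivity
    refine ⟨_, fun lam mu hl hlm => interaction_bound (p := p) (κ := γ)
      (fun r => deriv W r + c / r * W r) (fun r => deriv W r + c / r * W r) _ hM hM
      (toPow _ _ hM bW) bW ?_ ?_ ?_ hl (hl.trans hlm) ?_ ?_⟩
    · linarith
    · linarith
    · linarith
    · intro r hr; positivity
    · intro r hr
      rw [← hp, deriv_scaled hl hr, deriv_scaled (hl.trans hlm) hr, abs_mul, abs_mul,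
        abs_of_pos (by positivity : 0 < lam ^ (-p - 1)),
        abs_of_pos (Real.rpow_pos_of_pos (hl.trans hlm) (-p - 1)),
        show (N : ℝ) - 1 = 2 * p + 1 by linarith]
  have hN2 : -((N : ℝ) / 2) = -p - 1 := by rw [hNp]; ring
  have hN1 : (N : ℝ) - 1 = 2 * p + 1 := by rw [hNp]; ring
  have absprod : ∀ (F1 F2 : ℝ → ℝ) (lam mu r : ℝ), 0 < lam → 0 < mu →
      r ^ ((N : ℝ) - 1) * |lam ^ (-((N : ℝ) / 2)) * F1 (r / lam) *
            (mu ^ (-((N : ℝ) / 2)) * F2 (r / mu))| =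
      (lam ^ (-p - 1) * |F1 (r / lam)|) * (mu ^ (-p - 1) * |F2 (r / mu)|) * r ^ (2 * p + 1) := by
    intro F1 F2 lam mu r hl hm
    rw [hN2, hN1, abs_mul, abs_mul, abs_mul, abs_of_pos (Real.rpow_pos_of_pos hl _),
      abs_of_pos (Real.rpow_pos_of_pos hm _)]
    ring
  obtain ⟨C4, H4⟩ : ∃ C4 : ℝ, ∀ lam mu : ℝ, 0 < lam → lam < mu →
      (∫ x : EuclideanSpace ℝ (Fin N),
          |lam ^ (-((N : ℝ) / 2)) * ΛW (‖x‖ / lam) *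
            (mu ^ (-((N : ℝ) / 2)) * Λ₀ΛW (‖x‖ / mu))|) ≤ C4 * (lam / mu) ^ (γ - 1) := by
    have hM : 0 ≤ A * γ := by positivity
    refine ⟨V * (A * γ * M0 * ∫ t in Set.Ioi (0 : ℝ), phi β (p - (γ - 1) + -c) q0 t),
      fun lam mu hl hlm => ?_⟩
    rw [radial_integral hN (fun y => |lam ^ (-((N : ℝ) / 2)) * ΛW (y / lam) *
            (mu ^ (-((N : ℝ) / 2)) * Λ₀ΛW (y / mu))|), ← hV, mul_assoc]
    refine mul_le_mul_of_nonneg_left ?_ hV0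
    refine interaction_bound (p := p) (κ := γ - 1) ΛW Λ₀ΛW _ hM hM0 bL2' bL0 ?_ hq0 ?_ hl
      (hl.trans hlm) ?_ ?_
    · linarith
    · linarith
    · intro r hr; positivity
    · intro r hr
      exact (absprod ΛW Λ₀ΛW lam mu r hl (hl.trans hlm)).le
  obtain ⟨C3, H3⟩ : ∃ C3 : ℝ, ∀ lam mu : ℝ, 0 < lam → lam < mu →
      (∫ x : EuclideanSpace ℝ (Fin N),
          |lam ^ (-((N : ℝ) / 2)) * ΛW (‖x‖ / lam) *
            (mu ^ (-((N : ℝ) / 2)) * ΛW (‖x‖ / mu))|) ≤ C3 * (lam / mu) ^ (γ - 1) := by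
    have hM : 0 ≤ A * γ := by positivity
    rcases hγ1.eq_or_lt with h | h
    · -- endpoint: the integrand is not integrable
      refine ⟨0, fun lam mu hl hlm => ?_⟩
      have hm : 0 < mu := hl.trans hlm
      rw [radial_integral hN (fun y => |lam ^ (-((N : ℝ) / 2)) * ΛW (y / lam) *
            (mu ^ (-((N : ℝ) / 2)) * ΛW (y / mu))|)]
      have low : ∀ t : ℝ, 3 ≤ t → A * γ / 2 * 2 ^ (-p) * t ^ (-p - 1) ≤ |ΛW t| := by
        intro t ht
        have ht0 : 0 < t := by linarith
        have hs : 3 ≤ t ^ (2 * β) := by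
          calc (3 : ℝ) ≤ t := ht
            _ = t ^ (1 : ℝ) := (Real.rpow_one t).symm
            _ ≤ t ^ (2 * β) := Real.rpow_le_rpow_of_exponent_le (by linarith) (by linarith)
        have q1 := phi_pos β (-c) (p + 1) ht0
        have e1 : phi β (-c) p t = (1 + t ^ (2 * β)) * phi β (-c) (p + 1) t := by
          have := phi_succ β (-c) p ht0
          rw [show -c + 2 * β = 2 * β + -c by ring, ← phi_mul β (-c) (p + 1) (2 * β) ht0] at this
          linarith
        have e2 : 2 ^ (-p) * t ^ (-p - 1) ≤ phi β (-c) p t := by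
          unfold phi
          have : (2 * t ^ (2 * β)) ^ (-p) ≤ (1 + t ^ (2 * β)) ^ (-p) :=
            Real.rpow_le_rpow_of_nonpos (by positivity) (by linarith) (by linarith)
          rw [Real.mul_rpow (by norm_num) (by positivity), ← Real.rpow_mul ht0.le] at this
          calc (2 : ℝ) ^ (-p) * t ^ (-p - 1) = t ^ (-c) * (2 ^ (-p) * t ^ (2 * β * -p)) := by
                rw [mul_left_comm, ← Real.rpow_add ht0]
                congr 2
                rw [hcp]; linarith
            _ ≤ _ := by gcongr
        have e3 : phi β (-c) (p + 1) t * 4 ≤ phi β (-c) p t := by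
          rw [e1]; nlinarith
        rw [fL t ht0, abs_mul, abs_of_nonneg hM, div_mul_eq_mul_div, div_mul_eq_mul_div, mul_assoc,
          mul_div_assoc]
        refine mul_le_mul_of_nonneg_left ?_ hM
        rw [abs_sub_comm]
        refine le_trans ?_ (le_abs_self _)
        linarith
      have hni : ¬ IntegrableOn (fun r : ℝ => r ^ ((N : ℝ) - 1) *
          |lam ^ (-((N : ℝ) / 2)) * ΛW (r / lam) *
            (mu ^ (-((N : ℝ) / 2)) * ΛW (r / mu))|) (Set.Ioi 0) := by
        have hδ : 0 < (A * γ / 2 * 2 ^ (-p)) * (A * γ / 2 * 2 ^ (-p)) := by positivity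
        refine not_integrable_aux hδ (by positivity : 0 < 3 * mu) fun r hr => ?_
        have hr0 : 0 < r := lt_trans (by positivity) hr
        rw [absprod ΛW ΛW lam mu r hl hm]
        have a1 := low (r / lam) (by rw [le_div_iff₀ hl]; linarith)
        have a2 := low (r / mu) (by rw [le_div_iff₀ hm]; linarith)
        have key : r⁻¹ = lam ^ (-p - 1) * (r / lam) ^ (-p - 1) * (mu ^ (-p - 1) *
            (r / mu) ^ (-p - 1)) * r ^ (2 * p + 1) := by
          rw [← Real.mul_rpow hl.le (by positivity), ← Real.mul_rpow hm.le (by positivity),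
            mul_div_cancel₀ _ hl.ne', mul_div_cancel₀ _ hm.ne', ← Real.rpow_add hr0,
            ← Real.rpow_add hr0, ← Real.rpow_neg_one]
          congr 1; ring
        calc _ = (lam ^ (-p - 1) * (A * γ / 2 * 2 ^ (-p) * (r / lam) ^ (-p - 1))) *
            (mu ^ (-p - 1) * (A * γ / 2 * 2 ^ (-p) * (r / mu) ^ (-p - 1))) * r ^ (2 * p + 1) := by
              rw [key]; ring
          _ ≤ _ := by gcongr
      rw [integral_undef hni]
      simp
    · refine ⟨V * (A * γ * (A * γ) * ∫ t in Set.Ioi (0 : ℝ), phi β (p - (γ - 1) + -c) p t),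
        fun lam mu hl hlm => ?_⟩
      rw [radial_integral hN (fun y => |lam ^ (-((N : ℝ) / 2)) * ΛW (y / lam) *
            (mu ^ (-((N : ℝ) / 2)) * ΛW (y / mu))|), ← hV, mul_assoc]
      refine mul_le_mul_of_nonneg_left ?_ hV0
      refine interaction_bound (p := p) (κ := γ - 1) ΛW ΛW _ hM hM bL2' bL2 ?_ hp0.le ?_ hl
        (hl.trans hlm) ?_ ?_
      · linarith
      · linarith
      · intro r hr; positivity
      · intro r hr
        exact (absprod ΛW ΛW lam mu r hl (hl.trans hlm)).le
  have hexp : ((N : ℝ) - 2) * β / 2 = γ := by rw [hNp, hγ]; ring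
  refine ⟨|C1| + |C2| + |C3| + |C4| + 1, by positivity, fun lam mu hl hlm => ?_⟩
  have hm : 0 < mu := hl.trans hlm
  rw [hexp]
  have P1 : 0 ≤ (lam / mu) ^ γ := by positivity
  have P2 : 0 ≤ (lam / mu) ^ (γ - 1) := by positivity
  have a1 := le_abs_self C1
  have a2 := le_abs_self C2
  have a3 := le_abs_self C3
  have a4 := le_abs_self C4
  have b1 := abs_nonneg C1
  have b2 := abs_nonneg C2
  have b3 := abs_nonneg C3
  have b4 := abs_nonneg C4
  constructor
  · refine (add_le_add (H1 lam mu hl hlm) (H2 lam mu hl hlm)).trans ?_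
    rw [← add_mul]
    exact mul_le_mul_of_nonneg_right (by linarith) P1
  · refine (add_le_add (H3 lam mu hl hlm) (H4 lam mu hl hlm)).trans ?_
    rw [← add_mul]
    exact mul_le_mul_of_nonneg_right (by linarith) P2
end

section
/- Let N ≥ 3 be an integer, a > 0, β = √(1 + 4a/(N−2)²), c = (N−2)(1−β)/2, and α = −(N−2)(1+β)/2; assume ν := (N−2)β is an odd positive integer. Set k₁ = ⌊(ν+2)/4⌋ and k₂ = ⌊(ν+4)/4⌋, and let R > 0. Let u : ℝ × (0,∞) → ℝ be a C² function satisfying the radial linear wave equation with inverse-square potential ∂_t²u(t,r) = ∂_r²u(t,r) + ((N−1)/r)∂_r u(t,r) − (a/r²)u(t,r) for all (t,r), such that for every t the energy ∫₀^∞ ((∂_t u)² + (∂_r u)² + a u²/r²)(t,r) r^{N−1}dr is finite; set f = u(0,·) and g = ∂_t u(0,·). Then the maximum over the two time directions ± of liminf_{t→±∞} ∫_{|t|+R}^∞ ( (∂_t u(t,r))² + (∂_r u(t,r))² ) r^{N−1}dr is at least (1/2) · inf{ ∫_R^∞ | (f − Σ_{i=1}^{k₂} p_i r^{α+2i−2})'(r)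 + (c/r)(f − Σ_{i=1}^{k₂} p_i r^{α+2i−2})(r) |² r^{N−1}dr + ∫_R^∞ | g(r) − Σ_{j=1}^{k₁} q_j r^{α+2j−2} |² r^{N−1}dr : p ∈ ℝ^{k₂}, q ∈ ℝ^{k₁} }, i.e. at least half of the squared distance of the data (f, g), in Ḣ¹_a × L²(r ≥ R, r^{N−1}dr), to the plane P(R) spanned by (r^{α+2i−2}, 0), 1 ≤ i ≤ k₂, and (0, r^{α+2j−2}), 1 ≤ j ≤ k₁. -/
open MeasureTheory

namespace CE
open Set Filter Topology

/-- The half plane `r > 0`. -/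
def HP : Set (ℝ × ℝ) := {q | 0 < q.2}

lemma isOpen_HP : IsOpen HP := isOpen_lt continuous_const continuous_snd

lemma convex_HP : Convex ℝ HP := by
  have h := convex_halfSpace_gt (𝕜 := ℝ) (f := fun q : ℝ × ℝ => q.2) ⟨fun _ _ => rfl, fun _ _ => rfl⟩ 0
  exact h

/-- `F` is continuously differentiable on the half plane with the given partial derivatives. -/
structure C1 (F Ft Fr : ℝ → ℝ → ℝ) : Prop where
  ht : ∀ t r, 0 < r → HasDerivAt (fun s => F s r) (Ft t r) t
  hr : ∀ t r, 0 < r → HasDerivAt (F t) (Fr t r) r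
  ct : ContinuousOn (fun q : ℝ × ℝ => Ft q.1 q.2) HP
  cr : ContinuousOn (fun q : ℝ × ℝ => Fr q.1 q.2) HP

/-- The functional with given components. -/
noncomputable def lin (A B : ℝ) : ℝ × ℝ →L[ℝ] ℝ :=
  A • ContinuousLinearMap.fst ℝ ℝ ℝ + B • ContinuousLinearMap.snd ℝ ℝ ℝ

lemma lin_apply (A B : ℝ) (x : ℝ × ℝ) : lin A B x = A * x.1 + B * x.2 := by simp [lin]

lemma C1.hasFDerivAt {F Ft Fr} (h : C1 F Ft Fr) (t r : ℝ) (hr : 0 < r) :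
    HasFDerivAt (fun q : ℝ × ℝ => F q.1 q.2) (lin (Ft t r) (Fr t r)) (t, r) := by
  have hn : HP ∈ 𝓝 (t, r) := isOpen_HP.mem_nhds hr
  have := HasStrictFDerivAt.hasFDerivAt (hasStrictFDerivAt_uncurry_coprod (𝕜 := ℝ) (u := (t, r)) (f := F)
    (f₁ := fun t r => ContinuousLinearMap.toSpanSingleton ℝ (Ft t r))
    (f₂ := fun t r => ContinuousLinearMap.toSpanSingleton ℝ (Fr t r)) ?_ ?_ ?_ ?_)
  · have e : lin (Ft t r) (Fr t r) = (ContinuousLinearMap.toSpanSingleton ℝ (Ft t r)).coprod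
        (ContinuousLinearMap.toSpanSingleton ℝ (Fr t r)) := by
      ext <;> simp [lin]
    rw [e]
    exact this
  · filter_upwards [hn] with q hq using (h.ht q.1 q.2 hq).hasFDerivAt
  · filter_upwards [hn] with q hq using (h.hr q.1 q.2 hq).hasFDerivAt
  · exact (ContinuousLinearMap.toSpanSingletonCLE (𝕜 := ℝ) (E := ℝ)).continuous.continuousAt.comp
      (h.ct.continuousAt hn)
  · exact (ContinuousLinearMap.toSpanSingletonCLE (𝕜 := ℝ) (E := ℝ)).continuous.continuousAt.comp
      (h.cr.continuousAt hn)

lemma C1.cont {F Ft Fr} (h : C1 F Ft Fr) : ContinuousOn (fun q : ℝ × ℝ => F q.1 q.2) HP :=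
  fun q hq => (h.hasFDerivAt q.1 q.2 hq).continuousAt.continuousWithinAt

lemma C1.line {F Ft Fr} (h : C1 F Ft Fr) (b k t : ℝ) (hr : 0 < b + k * t) :
    HasDerivAt (fun s => F s (b + k * s)) (Ft t (b + k * t) + k * Fr t (b + k * t)) t := by
  have h1 : HasDerivAt (fun s : ℝ => (s, b + k * s)) ((1 : ℝ), k) t := by
    refine (hasDerivAt_id t).prodMk ?_
    simpa using ((hasDerivAt_id t).const_mul k).const_add b
  have := (h.hasFDerivAt t _ hr).comp_hasDerivAt t h1
  have e : Ft t (b + k * t) + k * Fr t (b + k * t) =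
      lin (Ft t (b + k * t)) (Fr t (b + k * t)) ((1 : ℝ), k) := by rw [lin_apply]; ring
  rw [e]
  exact this

/-- Slices in `r` of functions continuous on the half plane. -/
lemma slice {G : ℝ → ℝ → ℝ} (h : ContinuousOn (fun q : ℝ × ℝ => G q.1 q.2) HP) (t : ℝ) :
    ContinuousOn (G t) (Ioi 0) :=
  h.comp (f := fun r : ℝ => (t, r)) (by fun_prop) (fun _ hr => hr)

lemma poincare {A At Ar B Bt Br : ℝ → ℝ → ℝ} (hA : C1 A At Ar) (hB : C1 B Bt Br)
    (h : ∀ t r, 0 < r → Ar t r = Bt t r) : ∃ F, C1 F A B := by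
  have hd : ∀ x ∈ HP, HasFDerivAt (fun q : ℝ × ℝ => lin (A q.1 q.2) (B q.1 q.2))
      ((lin (At x.1 x.2) (Ar x.1 x.2)).smulRight (ContinuousLinearMap.fst ℝ ℝ ℝ) +
        (lin (Bt x.1 x.2) (Br x.1 x.2)).smulRight (ContinuousLinearMap.snd ℝ ℝ ℝ)) x := by
    intro x hx
    have h1 := (hA.hasFDerivAt x.1 x.2 hx).smul_const (ContinuousLinearMap.fst ℝ ℝ ℝ)
    have h2 := (hB.hasFDerivAt x.1 x.2 hx).smul_const (ContinuousLinearMap.snd ℝ ℝ ℝ)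
    exact h1.add h2
  obtain ⟨f, hf⟩ := convex_HP.exists_forall_hasFDerivAt_of_fderiv_symmetric (E := ℝ × ℝ) (F := ℝ)
    (ω := fun q : ℝ × ℝ => lin (A q.1 q.2) (B q.1 q.2)) isOpen_HP
    (fun x hx => (hd x hx).differentiableAt.differentiableWithinAt) (by
      intro a ha x y
      rw [(hd a ha).fderiv]
      simp [lin, h a.1 a.2 ha]
      ring)
  refine ⟨fun t r => f (t, r), ⟨?_, ?_, hA.cont, hB.cont⟩⟩
  · intro t r hr
    have := (hf (t, r) hr).comp_hasDerivAt t ((hasDerivAt_id t).prodMk (hasDerivAt_const t r))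
    have e : A t r = lin (A t r) (B t r) ((1 : ℝ), (0 : ℝ)) := by rw [lin_apply]; ring
    rw [e]
    exact this
  · intro t r hr
    have := (hf (t, r) hr).comp_hasDerivAt r ((hasDerivAt_const r t).prodMk (hasDerivAt_id r))
    have e : B t r = lin (A t r) (B t r) ((0 : ℝ), (1 : ℝ)) := by rw [lin_apply]; ring
    rw [e]
    exact this

lemma C1.congr {F Ft Fr Gt Gr} (h : C1 F Ft Fr) (h1 : ∀ t r, 0 < r → Gt t r = Ft t r)
    (h2 : ∀ t r, 0 < r → Gr t r = Fr t r) : C1 F Gt Gr where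
  ht t r hr := by rw [h1 t r hr]; exact h.ht t r hr
  hr t r hr := by rw [h2 t r hr]; exact h.hr t r hr
  ct := h.ct.congr fun q hq => h1 q.1 q.2 hq
  cr := h.cr.congr fun q hq => h2 q.1 q.2 hq

lemma C1.add {F Ft Fr G Gt Gr} (h : C1 F Ft Fr) (g : C1 G Gt Gr) :
    C1 (fun t r => F t r + G t r) (fun t r => Ft t r + Gt t r) (fun t r => Fr t r + Gr t r) where
  ht t r hr := (h.ht t r hr).add (g.ht t r hr)
  hr t r hr := (h.hr t r hr).add (g.hr t r hr)
  ct := h.ct.add g.ct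
  cr := h.cr.add g.cr

lemma C1.mul {F Ft Fr G Gt Gr} (h : C1 F Ft Fr) (g : C1 G Gt Gr) :
    C1 (fun t r => F t r * G t r) (fun t r => Ft t r * G t r + F t r * Gt t r)
      (fun t r => Fr t r * G t r + F t r * Gr t r) where
  ht t r hr := (h.ht t r hr).mul (g.ht t r hr)
  hr t r hr := (h.hr t r hr).mul (g.hr t r hr)
  ct := (h.ct.mul g.cont).add (h.cont.mul g.ct)
  cr := (h.cr.mul g.cont).add (h.cont.mul g.cr)

lemma C1.ofr {φ φ' : ℝ → ℝ} (h : ∀ r, 0 < r → HasDerivAt φ (φ' r) r)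
    (hc : ContinuousOn φ' (Ioi 0)) : C1 (fun _ r => φ r) (fun _ _ => 0) (fun _ r => φ' r) where
  ht t r hr := hasDerivAt_const _ _
  hr t r hr := h r hr
  ct := continuousOn_const
  cr := hc.comp (f := fun q : ℝ × ℝ => q.2) (by fun_prop) (fun _ hq => hq)

lemma C1.npow (c : ℝ) (k : ℕ) :
    C1 (fun _ r => c * r ^ k) (fun _ _ => 0) (fun _ r => c * (k * r ^ (k - 1))) :=
  C1.ofr (fun r _ => (hasDerivAt_pow k r).const_mul c) (by fun_prop)

/-- A `C²` solution of `v_tt = v_rr + (2m/r) v_r` with `p = v_t`, `y = v_r`. -/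
def Sol (m : ℕ) (v p y : ℝ → ℝ → ℝ) : Prop :=
  ∃ pt pr yr : ℝ → ℝ → ℝ, C1 v p y ∧ C1 p pt pr ∧ C1 y pr yr ∧
    ∀ t r, 0 < r → pt t r = yr t r + 2 * m / r * y t r

/-- Energy density. -/
def dens (m : ℕ) (p y : ℝ → ℝ → ℝ) (t r : ℝ) : ℝ := r ^ (2 * m) * (p t r ^ 2 + y t r ^ 2)

lemma Sol.contp {m v p y} (h : Sol m v p y) : ContinuousOn (fun q : ℝ × ℝ => p q.1 q.2) HP := by
  obtain ⟨_, _, _, h, _⟩ := h; exact h.ct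
lemma Sol.conty {m v p y} (h : Sol m v p y) : ContinuousOn (fun q : ℝ × ℝ => y q.1 q.2) HP := by
  obtain ⟨_, _, _, h, _⟩ := h; exact h.cr
lemma Sol.c1 {m v p y} (h : Sol m v p y) : C1 v p y := by
  obtain ⟨_, _, _, h, _⟩ := h; exact h

lemma Sol.contdens {m v p y} (h : Sol m v p y) (t : ℝ) : ContinuousOn (dens m p y t) (Ioi 0) := by
  have h1 := slice h.contp t
  have h2 := slice h.conty t
  unfold dens
  fun_prop

lemma ii {φ : ℝ → ℝ} (h : ContinuousOn φ (Ioi 0)) {X Y : ℝ} (hX : 0 < X) (hXY : X ≤ Y) :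
    IntervalIntegrable φ volume X Y :=
  (h.mono (fun x hx => lt_of_lt_of_le hX hx.1)).intervalIntegrable_of_Icc hXY

/-- FTC on the half line. -/
lemma ftc {Q φ : ℝ → ℝ} (hd : ∀ r, 0 < r → HasDerivAt Q (φ r) r) (h : ContinuousOn φ (Ioi 0))
    {X Y : ℝ} (hX : 0 < X) (hXY : X ≤ Y) : ∫ r in X..Y, φ r = Q Y - Q X := by
  apply intervalIntegral.integral_eq_sub_of_hasDerivAt
  · intro x hx
    rw [uIcc_of_le hXY] at hx
    exact hd x (lt_of_lt_of_le hX hx.1)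
  · exact ii h hX hXY

lemma dens_nonneg (m p y t r) : 0 ≤ dens m p y t r := by
  unfold dens
  have : (0:ℝ) ≤ r ^ (2 * m) := by rw [pow_mul]; positivity
  positivity

/-- Finite speed of propagation. -/
lemma finite_speed {m v p y} (h : Sol m v p y) {R : ℝ} (hR : 0 < R) (t Y : ℝ) (hY : |t| + R ≤ Y) :
    ∫ r in (|t| + R)..Y, dens m p y t r ≤ ∫ r in R..(Y + |t|), dens m p y 0 r := by
  have hc := h.contdens
  obtain ⟨pt, pr, yr, hv, hp, hy, heq⟩ := h
  have hA := (C1.npow 2 (2 * m)).mul (hp.mul hy)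
  have hB := (C1.npow 1 (2 * m)).mul ((hp.mul hp).add (hy.mul hy))
  obtain ⟨F, hF⟩ := poincare hA hB (by
    intro t r hr
    simp only [heq t r hr]
    rcases m with _ | m
    · simp; ring
    · have : 2 * (m + 1) - 1 = 2 * m + 1 := by omega
      rw [this]
      have h2 : 2 * (m + 1) = 2 * m + 1 + 1 := by ring
      rw [h2, pow_succ r (2 * m + 1)]
      push_cast
      field_simp
      ring)
  have hd : ∀ t r, dens m p y t r = 1 * r ^ (2 * m) * (p t r * p t r + y t r * y t r) := by
    intro t r; unfold dens; ring
  have hpos : ∀ r : ℝ, 0 ≤ r ^ (2 * m) := fun r => by rw [pow_mul]; positivity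
  have key : ∀ t X Y, 0 < X → X ≤ Y → ∫ r in X..Y, dens m p y t r = F t Y - F t X := by
    intro t X Y hX hXY
    exact ftc (fun r hr => by rw [hd]; exact hF.hr t r hr) (hc t) hX hXY
  have habs := abs_nonneg t
  rw [key t _ _ (by positivity) hY, key 0 _ _ hR (by linarith)]
  -- monotonicity along the two characteristic lines
  have low : F 0 R ≤ F t (|t| + R) := by
    rcases le_total 0 t with h0 | h0
    · have hm : MonotoneOn (fun s => F s (R + 1 * s)) (Icc 0 t) := by
        apply monotoneOn_of_hasDerivWithinAt_nonneg (convex_Icc 0 t)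
          (f' := fun s => 2 * (R + 1 * s) ^ (2 * m) * (p s (R + 1 * s) * y s (R + 1 * s)) + 1 *
            (1 * (R + 1 * s) ^ (2 * m) * (p s (R + 1 * s) * p s (R + 1 * s) + y s (R + 1 * s) * y s (R + 1 * s))))
        · intro s hs
          exact (hF.line R 1 s (by linarith [hs.1])).continuousAt.continuousWithinAt
        · intro s hs
          rw [interior_Icc] at hs
          exact (hF.line R 1 s (by linarith [hs.1])).hasDerivWithinAt
        · intro s hs
          nlinarith [mul_nonneg (hpos (R + 1 * s)) (sq_nonneg (p s (R + 1 * s) + y s (R + 1 * s)))]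
      have := hm (left_mem_Icc.2 h0) (right_mem_Icc.2 h0) h0
      simpa [abs_of_nonneg h0, add_comm] using this
    · have hm : AntitoneOn (fun s => F s (R + (-1) * s)) (Icc t 0) := by
        apply antitoneOn_of_hasDerivWithinAt_nonpos (convex_Icc t 0)
          (f' := fun s => 2 * (R + (-1) * s) ^ (2 * m) * (p s (R + (-1) * s) * y s (R + (-1) * s)) + (-1) *
            (1 * (R + (-1) * s) ^ (2 * m) * (p s (R + (-1) * s) * p s (R + (-1) * s) + y s (R + (-1) * s) * y s (R + (-1) * s))))
        · intro s hs
          exact (hF.line R (-1) s (by linarith [hs.2])).continuousAt.continuousWithinAt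
        · intro s hs
          rw [interior_Icc] at hs
          exact (hF.line R (-1) s (by linarith [hs.2])).hasDerivWithinAt
        · intro s hs
          nlinarith [mul_nonneg (hpos (R + (-1) * s)) (sq_nonneg (p s (R + (-1) * s) - y s (R + (-1) * s)))]
      have := hm (left_mem_Icc.2 h0) (right_mem_Icc.2 h0) h0
      simpa [abs_of_nonpos h0, add_comm] using this
  have high : F t Y ≤ F 0 (Y + |t|) := by
    rcases le_total 0 t with h0 | h0
    · rw [abs_of_nonneg h0] at *
      have hm : AntitoneOn (fun s => F s ((Y + t) + (-1) * s)) (Icc 0 t) := by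
        apply antitoneOn_of_hasDerivWithinAt_nonpos (convex_Icc 0 t)
          (f' := fun s => 2 * ((Y + t) + (-1) * s) ^ (2 * m) * (p s ((Y + t) + (-1) * s) * y s ((Y + t) + (-1) * s)) + (-1) *
            (1 * ((Y + t) + (-1) * s) ^ (2 * m) * (p s ((Y + t) + (-1) * s) * p s ((Y + t) + (-1) * s) + y s ((Y + t) + (-1) * s) * y s ((Y + t) + (-1) * s))))
        · intro s hs
          exact (hF.line (Y + t) (-1) s (by linarith [hs.2])).continuousAt.continuousWithinAt
        · intro s hs
          rw [interior_Icc] at hs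
          exact (hF.line (Y + t) (-1) s (by linarith [hs.2])).hasDerivWithinAt
        · intro s hs
          nlinarith [mul_nonneg (hpos ((Y + t) + (-1) * s)) (sq_nonneg (p s ((Y + t) + (-1) * s) - y s ((Y + t) + (-1) * s)))]
      have := hm (left_mem_Icc.2 h0) (right_mem_Icc.2 h0) h0
      simpa using this
    · rw [abs_of_nonpos h0] at *
      have hm : MonotoneOn (fun s => F s ((Y - t) + 1 * s)) (Icc t 0) := by
        apply monotoneOn_of_hasDerivWithinAt_nonneg (convex_Icc t 0)
          (f' := fun s => 2 * ((Y - t) + 1 * s) ^ (2 * m) * (p s ((Y - t) + 1 * s) * y s ((Y - t) + 1 * s)) + 1 *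
            (1 * ((Y - t) + 1 * s) ^ (2 * m) * (p s ((Y - t) + 1 * s) * p s ((Y - t) + 1 * s) + y s ((Y - t) + 1 * s) * y s ((Y - t) + 1 * s))))
        · intro s hs
          exact (hF.line (Y - t) 1 s (by linarith [hs.1])).continuousAt.continuousWithinAt
        · intro s hs
          rw [interior_Icc] at hs
          exact (hF.line (Y - t) 1 s (by linarith [hs.1])).hasDerivWithinAt
        · intro s hs
          nlinarith [mul_nonneg (hpos ((Y - t) + 1 * s)) (sq_nonneg (p s ((Y - t) + 1 * s) + y s ((Y - t) + 1 * s)))]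
      have := hm (left_mem_Icc.2 h0) (right_mem_Icc.2 h0) h0
      simpa [sub_eq_add_neg] using this
  linarith

end CE

namespace CE
open Set Filter Topology

lemma C1.congr3 {F Ft Fr G Gt Gr} (h : C1 F Ft Fr) (h0 : G = F)
    (h1 : ∀ t r, 0 < r → Gt t r = Ft t r)
    (h2 : ∀ t r, 0 < r → Gr t r = Fr t r) : C1 G Gt Gr := by
  subst h0; exact h.congr h1 h2

lemma decay (m : ℕ) {v y : ℝ → ℝ} (hv : ∀ r, 0 < r → HasDerivAt v (y r) r)
    (hy : ContinuousOn y (Ioi 0)) (h0 : Tendsto v atTop (𝓝 0)) {Y β : ℝ} (hY : 0 < Y)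
    (hb : ∀ Z, Y ≤ Z → ∫ r in Y..Z, r ^ (2 * m + 2) * y r ^ 2 ≤ β) :
    (2 * m + 1) * Y ^ (2 * m + 1) * v Y ^ 2 ≤ β := by
  set k : ℝ := 2 * m + 1 with hk
  set A : ℝ := v Y * Y ^ (2 * m + 1) with hA
  set Q : ℝ → ℝ := fun r => -2 * k * A * v r + k * A ^ 2 * (r ^ (2 * m + 1))⁻¹ with hQ
  have hQd : ∀ r, 0 < r → HasDerivAt Q
      (-2 * k * A * y r + k * A ^ 2 * (-(k * r ^ (2 * m)) / (r ^ (2 * m + 1)) ^ 2)) r := by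
    intro r hr
    have h1 := (hasDerivAt_pow (2 * m + 1) r).fun_inv (by positivity)
    have h2 := ((hv r hr).const_mul (-2 * k * A)).add (h1.const_mul (k * A ^ 2))
    exact h2.congr_deriv (by simp [hk])
  have hlim : Tendsto (fun Z => Q Z - Q Y) atTop (𝓝 (0 - Q Y)) := by
    refine Tendsto.sub_const ?_ _
    have h1 : Tendsto (fun r : ℝ => (r ^ (2 * m + 1))⁻¹) atTop (𝓝 0) :=
      (tendsto_pow_atTop (by omega)).inv_tendsto_atTop
    simpa [hQ] using (h0.const_mul (-2 * k * A)).add (h1.const_mul (k * A ^ 2))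
  have hle : ∀ᶠ Z in atTop, Q Z - Q Y ≤ β := by
    filter_upwards [eventually_ge_atTop Y] with Z hZ
    refine le_trans ?_ (hb Z hZ)
    apply intervalIntegral.sub_le_integral_of_hasDeriv_right_of_le hZ
      (g' := fun r => -2 * k * A * y r + k * A ^ 2 * (-(k * r ^ (2 * m)) / (r ^ (2 * m + 1)) ^ 2))
    · intro r hr
      exact (hQd r (lt_of_lt_of_le hY hr.1)).continuousAt.continuousWithinAt
    · intro r hr
      exact (hQd r (lt_trans hY hr.1)).hasDerivWithinAt
    · apply ContinuousOn.integrableOn_Icc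
      have : ContinuousOn y (Icc Y Z) := hy.mono (fun x hx => lt_of_lt_of_le hY hx.1)
      fun_prop
    · intro r hr
      have hr0 : 0 < r := lt_trans hY hr.1
      have e : r ^ (2 * m + 2) * y r ^ 2 -
        (-2 * k * A * y r + k * A ^ 2 * (-(k * r ^ (2 * m)) / (r ^ (2 * m + 1)) ^ 2))
         = (r ^ (m + 1) * y r + k * A / r ^ (m + 1)) ^ 2 := by
        field_simp
        ring
      nlinarith [sq_nonneg (r ^ (m + 1) * y r + k * A / r ^ (m + 1))]
  have := le_of_tendsto hlim hle
  have e : 0 - Q Y = k * Y ^ (2 * m + 1) * v Y ^ 2 := by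
    simp only [hQ, hA]
    field_simp
    ring
  linarith

/-- The pointwise identity behind both contractions, integrated. -/
lemma hardy (m : ℕ) {v y : ℝ → ℝ} (hv : ∀ r, 0 < r → HasDerivAt v (y r) r)
    (hy : ContinuousOn y (Ioi 0)) {X Y : ℝ} (hX : 0 < X) (hXY : X ≤ Y) :
    ∫ r in X..Y, r ^ (2 * m) * (r * y r + (2 * m + 1) * v r) ^ 2 =
      (∫ r in X..Y, r ^ (2 * m + 2) * y r ^ 2) +
        ((2 * m + 1) * Y ^ (2 * m + 1) * v Y ^ 2 - (2 * m + 1) * X ^ (2 * m + 1) * v X ^ 2) := by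
  have hvc : ContinuousOn v (Ioi 0) := fun r hr => (hv r hr).continuousAt.continuousWithinAt
  have h := ftc (Q := fun r => (2 * m + 1 : ℝ) * r ^ (2 * m + 1) * v r ^ 2)
    (φ := fun r => r ^ (2 * m) * (r * y r + (2 * m + 1) * v r) ^ 2 - r ^ (2 * m + 2) * y r ^ 2)
    (fun r hr => by
      have := ((hasDerivAt_pow (2 * m + 1) r).const_mul (2 * m + 1 : ℝ)).mul ((hv r hr).fun_pow 2)
      exact this.congr_deriv (by simp; ring)) (by fun_prop) hX hXY
  rw [← h, intervalIntegral.integral_sub]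
  · ring
  · exact ii (by fun_prop) hX hXY
  · exact ii (by fun_prop) hX hXY

/-- Backward contraction. -/
lemma back_contr (m : ℕ) {v p y : ℝ → ℝ → ℝ} (hv : C1 v p y) (t : ℝ)
    (h0 : Tendsto (v t) atTop (𝓝 0)) {X B : ℝ} (hX : 0 < X)
    (hb : ∀ Y, X ≤ Y → ∫ r in X..Y, dens (m + 1) p y t r ≤ B) :
    ∀ Y, X ≤ Y → ∫ r in X..Y,
      dens m (fun t r => r * y t r + (2 * m + 1) * v t r) (fun t r => r * p t r) t r ≤ B := by
  intro Y hXY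
  have hp := slice hv.ct t
  have hy := slice hv.cr t
  have hvc := slice hv.cont t
  have hY : 0 < Y := lt_of_lt_of_le hX hXY
  have hcd : ContinuousOn (dens (m + 1) p y t) (Ioi 0) := by unfold dens; fun_prop
  have hsplit : ∀ X Y, 0 < X → X ≤ Y → ∫ r in X..Y, dens (m + 1) p y t r =
      (∫ r in X..Y, r ^ (2 * m + 2) * p t r ^ 2) + ∫ r in X..Y, r ^ (2 * m + 2) * y t r ^ 2 := by
    intro X Y hX hXY
    rw [← intervalIntegral.integral_add (ii (by fun_prop) hX hXY) (ii (by fun_prop) hX hXY)]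
    congr 1; ext r; unfold dens; ring
  have hsplit2 : ∫ r in X..Y,
      dens m (fun t r => r * y t r + (2 * m + 1) * v t r) (fun t r => r * p t r) t r =
      (∫ r in X..Y, r ^ (2 * m + 2) * p t r ^ 2) +
       ∫ r in X..Y, r ^ (2 * m) * (r * y t r + (2 * m + 1) * v t r) ^ 2 := by
    rw [← intervalIntegral.integral_add (ii (by fun_prop) hX hXY) (ii (by fun_prop) hX hXY)]
    congr 1; ext r; unfold dens; ring
  have hd := decay m (hv.hr t) hy h0 hY (β := B - ∫ r in X..Y, dens (m + 1) p y t r) (by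
    intro Z hZ
    have h1 := hb Z (hXY.trans hZ)
    rw [← intervalIntegral.integral_add_adjacent_intervals (ii hcd hX hXY) (ii hcd hY hZ),
      hsplit Y Z hY hZ] at h1
    have h2 : 0 ≤ ∫ r in Y..Z, r ^ (2 * m + 2) * p t r ^ 2 := by
      apply intervalIntegral.integral_nonneg hZ
      intro r hr
      have : 0 < r := lt_of_lt_of_le hY hr.1
      positivity
    linarith)
  rw [hsplit2, hardy m (hv.hr t) hy hX hXY]
  rw [hsplit X Y hX hXY] at hd
  have : 0 ≤ (2 * m + 1) * X ^ (2 * m + 1) * v t X ^ 2 := by positivity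
  linarith

/-- Integrability from bounded partial integrals. -/
lemma integrableOn_of_bdd {φ : ℝ → ℝ} (hc : ContinuousOn φ (Ioi 0)) (hn : ∀ r, 0 < r → 0 ≤ φ r)
    {X B : ℝ} (hX : 0 < X) (hb : ∀ Y, X ≤ Y → ∫ r in X..Y, φ r ≤ B) : IntegrableOn φ (Ioi X) := by
  apply integrableOn_Ioi_of_intervalIntegral_norm_bounded (b := id) (l := atTop) B X
  · intro i
    apply ContinuousOn.integrableOn_Icc (a := X) (b := i) ?_ |>.mono_set Ioc_subset_Icc_self
    exact hc.mono fun x hx => lt_of_lt_of_le hX hx.1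
  · exact tendsto_id
  · filter_upwards [eventually_ge_atTop X] with Y hY
    refine le_trans (le_of_eq ?_) (hb Y hY)
    apply intervalIntegral.integral_congr
    intro r hr
    rw [id, uIcc_of_le hY] at hr
    simp [abs_of_nonneg (hn r (lt_of_lt_of_le hX hr.1))]

lemma descend (m : ℕ) {v p y : ℝ → ℝ → ℝ} (hs : Sol (m + 1) v p y)
    (h0 : ∀ t, Tendsto (v t) atTop (𝓝 0)) {R C : ℝ} (hR : 0 < R)
    (hb : ∀ t Y, |t| + R ≤ Y → ∫ r in (|t| + R)..Y, dens (m + 1) p y t r ≤ C) :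
    ∃ w, Sol m w (fun t r => r * y t r + (2 * m + 1) * v t r) (fun t r => r * p t r) ∧
      (1 ≤ m → ∀ t, Tendsto (w t) atTop (𝓝 0)) := by
  have hcd := hs.contdens
  obtain ⟨pt, pr, yr, hv, hp, hy, heq⟩ := hs
  have c1 : C1 (fun t r => r * y t r + (2 * m + 1) * v t r)
      (fun t r => r * pr t r + (2 * m + 1) * p t r)
      (fun t r => r * yr t r + (2 * m + 2) * y t r) :=
    (((C1.npow 1 1).mul hy).add ((C1.npow (2 * m + 1) 0).mul hv)).congr3 (by simp) (by intros; simp)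
      (by intros; simp; ring)
  have c2 : C1 (fun t r => r * p t r) (fun t r => r * yr t r + (2 * m + 2) * y t r)
      (fun t r => p t r + r * pr t r) :=
    ((C1.npow 1 1).mul hp).congr3 (by simp) (by
      intro t r hr
      rw [heq t r hr]
      push_cast
      field_simp
      ring) (by intros; simp)
  obtain ⟨w, hw⟩ := poincare c1 c2 (fun _ _ _ => rfl)
  have solw : ∀ κ : ℝ, Sol m (fun t r => w t r - κ)
      (fun t r => r * y t r + (2 * m + 1) * v t r) (fun t r => r * p t r) := by
    intro κ
    refine ⟨_, _, _, ⟨?_, ?_, hw.ct, hw.cr⟩, c1, c2, ?_⟩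
    · intro t r hr; exact (hw.ht t r hr).sub_const κ
    · intro t r hr; exact (hw.hr t r hr).sub_const κ
    · intro t r hr
      field_simp
      ring
  by_cases hm : 1 ≤ m
  swap
  · exact ⟨_, solw 0, fun h => absurd h hm⟩
  -- existence of limits
  have hlim : ∀ t, ∃ κ, Tendsto (w t) atTop (𝓝 κ) := by
    intro t
    have hX : 0 < |t| + R := by positivity
    refine ⟨_, tendsto_limUnder_of_hasDerivAt_of_integrableOn_Ioi (a := |t| + R + 1)
      (f' := fun r => r * p t r) ?_ ?_⟩
    · intro r hr
      exact hw.hr t r (by have := mem_Ioi.1 hr; linarith)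
    · have i1 := (integrableOn_of_bdd (hcd t) (fun r _ => dens_nonneg _ _ _ _ _) hX (hb t)).mono_set
        (Ioi_subset_Ioi (show |t| + R ≤ |t| + R + 1 by linarith))
      have i2 : IntegrableOn (fun r : ℝ => r ^ (-2 : ℝ)) (Ioi (|t| + R + 1)) :=
        integrableOn_Ioi_rpow_of_lt (by norm_num) (by positivity)
      refine (i1.add i2).mono' ?_ ?_
      · apply ContinuousOn.aestronglyMeasurable ?_ measurableSet_Ioi
        have := (slice hv.ct t).mono (Ioi_subset_Ioi (show (0:ℝ) ≤ |t| + R + 1 by positivity))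
        fun_prop
      · rw [ae_restrict_iff' measurableSet_Ioi]
        refine Eventually.of_forall fun r hr => ?_
        have hr1 : 1 < r := by have := mem_Ioi.1 hr; linarith
        have hr0 : 0 < r := by linarith
        simp only [Pi.add_apply, dens]
        rw [Real.rpow_neg hr0.le, Real.norm_eq_abs]
        norm_cast
        have e1 : |r * p t r| ≤ r ^ 4 * p t r ^ 2 + (r ^ 2)⁻¹ := by
          have h1 : 0 ≤ (r ^ 2 * |p t r| - r⁻¹) ^ 2 := sq_nonneg _
          have h2 : (r ^ 2 * |p t r| - r⁻¹) ^ 2 = r ^ 4 * p t r ^ 2 + (r ^ 2)⁻¹ - 2 * (r * |p t r|) := by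
            rw [← sq_abs (p t r)]
            field_simp
            ring
          rw [abs_mul, abs_of_pos hr0]
          have : 0 ≤ r * |p t r| := by positivity
          linarith
        have e2 : r ^ 4 ≤ r ^ (2 * (m + 1)) := pow_le_pow_right₀ hr1.le (by omega)
        have e3 : r ^ 4 * p t r ^ 2 ≤ r ^ (2 * (m + 1)) * (p t r ^ 2 + y t r ^ 2) := by
          have : 0 ≤ r ^ (2 * (m + 1)) * y t r ^ 2 := by positivity
          nlinarith [mul_le_mul_of_nonneg_right e2 (sq_nonneg (p t r))]
        linarith
  choose κ hκ using hlim
  refine ⟨_, solw (κ 0), fun _ t => ?_⟩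
  suffices hkk : κ t = κ 0 by
    have := (hκ t).sub_const (κ 0)
    rwa [hkk, sub_self] at this
  -- bound for v
  have hvb : ∀ s r, |s| + R ≤ r → 1 ≤ r → |r ^ m * v s r| ≤ C + 1 := by
    intro s r hsr hr1
    have hX : 0 < |s| + R := by positivity
    have hr0 : 0 < r := by linarith
    have hy' := slice hv.cr s
    have hp' := slice hv.ct s
    have := decay m (hv.hr s) (slice hv.cr s) (h0 s) hr0 (β := C) (by
      intro Z hZ
      have hcc : ContinuousOn (fun r => r ^ (2 * m + 2) * y s r ^ 2) (Ioi 0) := by fun_prop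
      calc ∫ r in r..Z, r ^ (2 * m + 2) * y s r ^ 2 ≤ ∫ r in r..Z, dens (m + 1) p y s r := by
            apply intervalIntegral.integral_mono_on hZ (ii hcc hr0 hZ) (ii (hcd s) hr0 hZ)
            intro x hx
            have : 0 < x := lt_of_lt_of_le hr0 hx.1
            unfold dens
            have : 0 ≤ x ^ (2 * m + 2) * p s x ^ 2 := by positivity
            rw [show 2 * (m + 1) = 2 * m + 2 by ring]
            linarith
        _ ≤ (∫ r in (|s| + R)..r, dens (m + 1) p y s r) + ∫ r in r..Z, dens (m + 1) p y s r := by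
            have := intervalIntegral.integral_nonneg (μ := volume) hsr (f := dens (m + 1) p y s)
              (fun x _ => dens_nonneg _ _ _ _ _)
            linarith
        _ = ∫ r in (|s| + R)..Z, dens (m + 1) p y s r :=
            intervalIntegral.integral_add_adjacent_intervals (ii (hcd s) hX hsr) (ii (hcd s) hr0 hZ)
        _ ≤ C := hb s Z (hsr.trans hZ))
    have h2 : (r ^ m * v s r) ^ 2 ≤ C := by
      refine le_trans ?_ this
      have e : (r ^ m * v s r) ^ 2 = 1 * r ^ (2 * m) * v s r ^ 2 := by ring
      rw [e]
      gcongr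
      · have : (0:ℝ) ≤ m := by positivity
        linarith
      · omega
    rw [abs_le]
    constructor <;> nlinarith [sq_nonneg (r ^ m * v s r - 1), sq_nonneg (r ^ m * v s r + 1)]
  have hC : 0 ≤ C := by
    have := hb 0 (|(0:ℝ)| + R) le_rfl
    simpa using this
  -- second potential
  obtain ⟨Ψ, hΨ⟩ := poincare ((C1.npow 1 (2 * m + 1)).mul hv) ((C1.npow 1 (2 * m)).mul hw) (by
    intro s r hr
    simp
    ring)
  have hbound : ∀ X, |t| + R + 1 ≤ X → ∃ ξ, X ≤ ξ ∧
      |w t ξ - w 0 ξ| ≤ (|t| * (2 * (C + 1) * 2 ^ (m + 1))) / X := by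
    intro X hX
    have habs := abs_nonneg t
    have hX1 : 1 ≤ X := by linarith
    have hX0 : 0 < X := by linarith
    obtain ⟨ξ, hξ, hξe⟩ := exists_hasDerivAt_eq_slope (fun r => Ψ t r - Ψ 0 r)
      (fun r => r ^ (2 * m) * w t r - r ^ (2 * m) * w 0 r) (show X < 2 * X by linarith)
      (by
        intro r hr
        have hr0 : 0 < r := lt_of_lt_of_le hX0 hr.1
        exact ((hΨ.hr t r hr0).sub (hΨ.hr 0 r hr0)).continuousAt.continuousWithinAt)
      (by
        intro r hr
        have hr0 : 0 < r := lt_trans hX0 hr.1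
        exact ((hΨ.hr t r hr0).sub (hΨ.hr 0 r hr0)).congr_deriv (by simp))
    refine ⟨ξ, hξ.1.le, ?_⟩
    have hD : |(Ψ t (2 * X) - Ψ t X) - (Ψ 0 (2 * X) - Ψ 0 X)| ≤ (2 * (C + 1) * (2 * X) ^ (m + 1)) * |t - 0| := by
      have := (convex_uIcc 0 t).norm_image_sub_le_of_norm_hasDerivWithin_le
        (f := fun s => Ψ s (2 * X) - Ψ s X)
        (f' := fun s => (2 * X) ^ (2 * m + 1) * v s (2 * X) - X ^ (2 * m + 1) * v s X)
        (C := 2 * (C + 1) * (2 * X) ^ (m + 1)) (x := 0) (y := t)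
        (by
          intro s _
          have := (hΨ.ht s (2 * X) (by positivity)).sub (hΨ.ht s X (by positivity))
          simp only [one_mul] at this
          exact this.hasDerivWithinAt)
        (by
          intro s hs'
          have hst : |s| ≤ |t| := by
            have := abs_sub_left_of_mem_uIcc hs'
            simpa using this
          have a1 := hvb s (2 * X) (by linarith) (by linarith)
          have a2 := hvb s X (by linarith) (by linarith)
          have e1 : (2 * X) ^ (2 * m + 1) * v s (2 * X) = (2 * X) ^ (m + 1) * ((2 * X) ^ m * v s (2 * X)) := by ring
          have e2 : X ^ (2 * m + 1) * v s X = X ^ (m + 1) * (X ^ m * v s X) := by ring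
          rw [e1, e2, Real.norm_eq_abs]
          have b1 : |(2 * X) ^ (m + 1) * ((2 * X) ^ m * v s (2 * X))| ≤ (2 * X) ^ (m + 1) * (C + 1) := by
            rw [abs_mul, abs_of_pos (by positivity : 0 < (2 * X) ^ (m + 1))]
            gcongr
          have b2 : |X ^ (m + 1) * (X ^ m * v s X)| ≤ (2 * X) ^ (m + 1) * (C + 1) := by
            rw [abs_mul, abs_of_pos (by positivity : 0 < X ^ (m + 1))]
            gcongr
            linarith
          rw [abs_le] at b1 b2 ⊢
          constructor <;> linarith [b1.1, b1.2, b2.1, b2.2])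
        left_mem_uIcc right_mem_uIcc
      simpa using this
    have e : X * ξ ^ (2 * m) * (w t ξ - w 0 ξ) = (Ψ t (2 * X) - Ψ t X) - (Ψ 0 (2 * X) - Ψ 0 X) := by
      have : ξ ^ (2 * m) * w t ξ - ξ ^ (2 * m) * w 0 ξ =
        ((Ψ t (2 * X) - Ψ 0 (2 * X)) - (Ψ t X - Ψ 0 X)) / (2 * X - X) := hξe
      rw [show 2 * X - X = X by ring, eq_div_iff hX0.ne'] at this
      linarith
    rw [← e, sub_zero, abs_mul, abs_of_pos (by have := hX0.trans hξ.1; positivity)] at hD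
    rw [le_div_iff₀ hX0]
    have hξm : X ^ (m + 1) ≤ ξ ^ (2 * m) := by
      calc X ^ (m + 1) ≤ X ^ (2 * m) := pow_le_pow_right₀ hX1 (by omega)
        _ ≤ ξ ^ (2 * m) := pow_le_pow_left₀ hX0.le hξ.1.le _
    have hw0 := abs_nonneg (w t ξ - w 0 ξ)
    have h3 : X ^ (m + 1) * (|w t ξ - w 0 ξ| * X) ≤ X ^ (m + 1) * (|t| * (2 * (C + 1) * 2 ^ (m + 1))) := by
      calc _ ≤ ξ ^ (2 * m) * (|w t ξ - w 0 ξ| * X) := by gcongr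
        _ = X * ξ ^ (2 * m) * |w t ξ - w 0 ξ| := by ring
        _ ≤ _ := hD
        _ = _ := by rw [mul_pow]; ring
    exact le_of_mul_le_mul_left h3 (by positivity)
  by_contra hne
  have hδ : 0 < |κ t - κ 0| := abs_pos.2 (sub_ne_zero.2 hne)
  have ht1 : Tendsto (fun r => |w t r - w 0 r|) atTop (𝓝 |κ t - κ 0|) := ((hκ t).sub (hκ 0)).abs
  have ev1 := ht1.eventually (lt_mem_nhds (show |κ t - κ 0| / 2 < |κ t - κ 0| by linarith))
  obtain ⟨X0, hX0⟩ := eventually_atTop.1 ev1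
  have ht2 : Tendsto (fun X => (|t| * (2 * (C + 1) * 2 ^ (m + 1))) / X) atTop (𝓝 0) :=
    tendsto_const_nhds.div_atTop tendsto_id
  have ev2 := ht2.eventually (gt_mem_nhds (show 0 < |κ t - κ 0| / 2 by linarith))
  obtain ⟨X, h1, h2, h3⟩ := (ev2.and ((eventually_ge_atTop X0).and
    (eventually_ge_atTop (|t| + R + 1)))).exists
  obtain ⟨ξ, hξ1, hξ2⟩ := hbound X h3
  have := hX0 ξ (h2.trans hξ1)
  linarith

end CE

namespace CE
open Set Filter Topology

/-- Constancy of a function with zero derivative on an interval. -/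
lemma const_of_deriv_zero {φ : ℝ → ℝ} {a b : ℝ} (h : ∀ s ∈ uIcc a b, HasDerivAt φ 0 s) :
    φ b = φ a := by
  have := (convex_uIcc a b).norm_image_sub_le_of_norm_hasDerivWithin_le (f := φ) (f' := fun _ => 0)
    (C := 0) (x := a) (y := b) (fun s hs => (h s hs).hasDerivWithinAt) (by simp)
    left_mem_uIcc right_mem_uIcc
  simp at this
  linarith

lemma base {v p y : ℝ → ℝ → ℝ} (hs : Sol 0 v p y) {R : ℝ} (hR : 0 < R)
    {t₁ t₂ B₁ B₂ : ℝ} (h₁ : 0 ≤ t₁) (h₂ : t₂ ≤ 0)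
    (hb₁ : ∀ Y, |t₁| + R ≤ Y → ∫ r in (|t₁| + R)..Y, dens 0 p y t₁ r ≤ B₁)
    (hb₂ : ∀ Y, |t₂| + R ≤ Y → ∫ r in (|t₂| + R)..Y, dens 0 p y t₂ r ≤ B₂) (Y : ℝ) (hY : R ≤ Y) :
    ∫ r in R..Y, dens 0 p y 0 r ≤ B₁ + B₂ := by
  rw [abs_of_nonneg h₁] at hb₁
  rw [abs_of_nonpos h₂] at hb₂
  have hcd := hs.contdens
  obtain ⟨pt, pr, yr, hv, hp, hy, heq⟩ := hs
  have c₁ : ∀ b, 0 < b → p t₁ (b + t₁) - y t₁ (b + t₁) = p 0 b - y 0 b := by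
    intro b hb
    have := const_of_deriv_zero (φ := fun s => p s (b + 1 * s) - y s (b + 1 * s)) (a := 0) (b := t₁) (by
      intro s hs
      rw [uIcc_of_le h₁] at hs
      have hpos : 0 < b + 1 * s := by linarith [hs.1]
      refine ((hp.line b 1 s hpos).sub (hy.line b 1 s hpos)).congr_deriv ?_
      rw [heq _ _ hpos]
      simp; ring)
    simpa using this
  have c₂ : ∀ b, 0 < b → p t₂ (b + -t₂) + y t₂ (b + -t₂) = p 0 b + y 0 b := by
    intro b hb
    have := const_of_deriv_zero (φ := fun s => p s (b + (-1) * s) + y s (b + (-1) * s)) (a := 0) (b := t₂) (by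
      intro s hs
      rw [uIcc_of_ge h₂] at hs
      have hpos : 0 < b + (-1) * s := by linarith [hs.2]
      refine ((hp.line b (-1) s hpos).add (hy.line b (-1) s hpos)).congr_deriv ?_
      rw [heq _ _ hpos]
      simp)
    simpa using this
  have e₁ : ∫ r in R..Y, dens 0 p y t₁ (r + t₁) ≤ B₁ := by
    rw [intervalIntegral.integral_comp_add_right (fun r => dens 0 p y t₁ r), add_comm R t₁]
    exact hb₁ _ (by linarith)
  have e₂ : ∫ r in R..Y, dens 0 p y t₂ (r + -t₂) ≤ B₂ := by
    rw [intervalIntegral.integral_comp_add_right (fun r => dens 0 p y t₂ r), add_comm R (-t₂)]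
    exact hb₂ _ (by linarith)
  have k₁ : ContinuousOn (fun r => dens 0 p y t₁ (r + t₁)) (Ioi 0) :=
    (hcd t₁).comp (by fun_prop) (fun r hr => by have := mem_Ioi.1 hr; simp; linarith)
  have k₂ : ContinuousOn (fun r => dens 0 p y t₂ (r + -t₂)) (Ioi 0) :=
    (hcd t₂).comp (by fun_prop) (fun r hr => by have := mem_Ioi.1 hr; simp; linarith)
  calc ∫ r in R..Y, dens 0 p y 0 r
      ≤ ∫ r in R..Y, (dens 0 p y t₁ (r + t₁) + dens 0 p y t₂ (r + -t₂)) := by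
        apply intervalIntegral.integral_mono_on hY (ii (hcd 0) hR hY)
          ((ii k₁ hR hY).add (ii k₂ hR hY))
        intro r hr
        have hr0 : 0 < r := lt_of_lt_of_le hR hr.1
        have f₁ := c₁ r hr0
        have f₂ := c₂ r hr0
        simp only [dens, mul_zero, pow_zero, one_mul]
        generalize p t₁ (r + t₁) = a1 at *
        generalize y t₁ (r + t₁) = a2 at *
        generalize p t₂ (r + -t₂) = b1 at *
        generalize y t₂ (r + -t₂) = b2 at *
        generalize p 0 r = x1 at *
        generalize y 0 r = x2 at *
        have g1 : (a1 - a2) ^ 2 = (x1 - x2) ^ 2 := by rw [f₁]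
        have g2 : (b1 + b2) ^ 2 = (x1 + x2) ^ 2 := by rw [f₂]
        nlinarith [sq_nonneg (a1 + a2), sq_nonneg (b1 - b2)]
    _ = (∫ r in R..Y, dens 0 p y t₁ (r + t₁)) + ∫ r in R..Y, dens 0 p y t₂ (r + -t₂) :=
        intervalIntegral.integral_add (ii k₁ hR hY) (ii k₂ hR hY)
    _ ≤ B₁ + B₂ := add_le_add e₁ e₂

/-- Density of the remainder after removing the explicit powers. -/
noncomputable def rem (m : ℕ) (p y : ℝ → ℝ) (a b : ℕ → ℝ) (r : ℝ) : ℝ :=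
  r ^ (2 * m) * ((p r - ∑ i ∈ Finset.range (m / 2), b i * r ^ (-(2 * m - 1 : ℝ) + 2 * i)) ^ 2 +
    (y r - ∑ i ∈ Finset.range ((m + 1) / 2), a i * r ^ (-(2 * m : ℝ) + 2 * i)) ^ 2)

lemma contpow (e : ℝ) : ContinuousOn (fun r : ℝ => r ^ e) (Ioi 0) :=
  fun r hr => (Real.continuousAt_rpow_const r e (Or.inl (ne_of_gt hr))).continuousWithinAt

lemma contsum (n : ℕ) (b : ℕ → ℝ) (e : ℕ → ℝ) :
    ContinuousOn (fun r : ℝ => ∑ i ∈ Finset.range n, b i * r ^ (e i)) (Ioi 0) :=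
  continuousOn_finsetSum _ fun i _ => continuousOn_const.mul (contpow (e i))

theorem key (m : ℕ) : ∀ (v p y : ℝ → ℝ → ℝ) (R C : ℝ), 0 < R → Sol m v p y →
    (1 ≤ m → ∀ t, Tendsto (v t) atTop (𝓝 0)) →
    (∀ t Y, |t| + R ≤ Y → ∫ r in (|t| + R)..Y, dens m p y t r ≤ C) →
    ∀ t₁ t₂ B₁ B₂ : ℝ, 0 ≤ t₁ → t₂ ≤ 0 →
    (∀ Y, |t₁| + R ≤ Y → ∫ r in (|t₁| + R)..Y, dens m p y t₁ r ≤ B₁) →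
    (∀ Y, |t₂| + R ≤ Y → ∫ r in (|t₂| + R)..Y, dens m p y t₂ r ≤ B₂) →
    ∃ a b : ℕ → ℝ, ∀ Y, R ≤ Y → ∫ r in R..Y, rem m (p 0) (y 0) a b r ≤ B₁ + B₂ := by
  induction m with
  | zero =>
    intro v p y R C hR hs _ _ t₁ t₂ B₁ B₂ h₁ h₂ hb₁ hb₂
    refine ⟨0, 0, fun Y hY => ?_⟩
    refine le_trans (le_of_eq ?_) (base hs hR h₁ h₂ hb₁ hb₂ Y hY)
    congr 1
    ext r
    simp [rem, dens]
  | succ m ih =>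
    intro v p y R C hR hs h0 hC t₁ t₂ B₁ B₂ h₁ h₂ hb₁ hb₂
    have h0 := h0 (by omega)
    obtain ⟨w, hw, hw0⟩ := descend m hs h0 hR hC
    have hv := hs.c1
    obtain ⟨a', b', hab⟩ := ih w _ _ R C hR hw hw0
      (fun t => back_contr m hv t (h0 t) (by positivity) (hC t)) t₁ t₂ B₁ B₂ h₁ h₂
      (back_contr m hv t₁ (h0 t₁) (by positivity) hb₁)
      (back_contr m hv t₂ (h0 t₂) (by positivity) hb₂)
    -- the corrected function
    set bb : ℕ → ℝ := fun i => b' i / (2 * i + 2) with hbb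
    set S : ℝ → ℝ := fun r => ∑ i ∈ Finset.range (m / 2), bb i * r ^ (-(2 * m - 1 : ℝ) + 2 * i) with hS
    set κ : ℝ := (v 0 R - S R) / R ^ (-(2 * m + 1 : ℝ)) with hκ
    set V : ℝ → ℝ := fun r => v 0 r - S r - κ * r ^ (-(2 * m + 1 : ℝ)) with hV
    set a : ℕ → ℝ := fun i => Nat.casesOn i (κ * (-(2 * m + 1)))
      (fun i => bb i * (-(2 * m - 1 : ℝ) + 2 * i)) with ha
    set T : ℝ → ℝ := fun r => ∑ i ∈ Finset.range ((m + 1 + 1) / 2), a i * r ^ (-(2 * ((m + 1 : ℕ) : ℝ)) + 2 * i) with hT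
    have hTe : ∀ r, T r = (∑ i ∈ Finset.range (m / 2), bb i * ((-(2 * m - 1 : ℝ) + 2 * i) *
        r ^ (-(2 * m - 1 : ℝ) + 2 * i - 1))) + κ * (-(2 * m + 1 : ℝ) * r ^ (-(2 * m + 1 : ℝ) - 1)) := by
      intro r
      simp only [hT]
      rw [show (m + 1 + 1) / 2 = m / 2 + 1 by omega, Finset.sum_range_succ']
      congr 1
      · apply Finset.sum_congr rfl
        intro i _
        simp only [ha]
        rw [mul_assoc]
        congr 3
        push_cast; ring
      · show κ * (-(2 * m + 1)) * r ^ (-(2 * ((m + 1 : ℕ) : ℝ)) + 2 * ((0 : ℕ) : ℝ)) = _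
        rw [mul_assoc]
        congr 3
        push_cast; ring
    have hSd : ∀ r, 0 < r → HasDerivAt S (∑ i ∈ Finset.range (m / 2), bb i * ((-(2 * m - 1 : ℝ) + 2 * i) *
        r ^ (-(2 * m - 1 : ℝ) + 2 * i - 1))) r := by
      intro r hr
      apply HasDerivAt.fun_sum
      intro i _
      exact (Real.hasDerivAt_rpow_const (Or.inl hr.ne')).const_mul _
    have hVd : ∀ r, 0 < r → HasDerivAt V (y 0 r - T r) r := by
      intro r hr
      refine (((hv.hr 0 r hr).sub (hSd r hr)).sub
        ((Real.hasDerivAt_rpow_const (p := -(2 * m + 1 : ℝ)) (Or.inl hr.ne')).const_mul κ)).congr_deriv ?_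
      rw [hTe]; ring
    have hVR : V R = 0 := by
      simp only [hV, hκ]
      have : R ^ (-(2 * m + 1 : ℝ)) ≠ 0 := (Real.rpow_pos_of_pos hR _).ne'
      field_simp
      ring
    have hTc : ContinuousOn T (Ioi 0) := contsum _ _ _
    have hyc := slice hv.cr 0
    have hpc := slice hv.ct 0
    have hVc : ContinuousOn (fun r => y 0 r - T r) (Ioi 0) := hyc.sub hTc
    have hVc0 : ContinuousOn V (Ioi 0) := fun r hr => (hVd r hr).continuousAt.continuousWithinAt
    have hVh : ∀ r, 0 < r → r * (y 0 r - T r) + (2 * m + 1) * V r =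
        r * y 0 r + (2 * m + 1) * v 0 r -
          ∑ i ∈ Finset.range (m / 2), b' i * r ^ (-(2 * m - 1 : ℝ) + 2 * i) := by
      intro r hr
      rw [hTe]
      simp only [hV, hS]
      have e1 : r * r ^ (-(2 * m + 1 : ℝ) - 1) = r ^ (-(2 * m + 1 : ℝ)) := by
        rw [Real.rpow_sub_one hr.ne']; field_simp
      have e2 : r * (∑ i ∈ Finset.range (m / 2), bb i * ((-(2 * m - 1 : ℝ) + 2 * i) *
          r ^ (-(2 * m - 1 : ℝ) + 2 * i - 1))) + (2 * m + 1) *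
          (∑ i ∈ Finset.range (m / 2), bb i * r ^ (-(2 * m - 1 : ℝ) + 2 * i)) =
          ∑ i ∈ Finset.range (m / 2), b' i * r ^ (-(2 * m - 1 : ℝ) + 2 * i) := by
        rw [Finset.mul_sum, Finset.mul_sum, ← Finset.sum_add_distrib]
        apply Finset.sum_congr rfl
        intro i _
        have hi : (2 * (i : ℝ) + 2) ≠ 0 := by positivity
        rw [Real.rpow_sub_one hr.ne']
        simp only [hbb]
        field_simp
        ring
      linear_combination -e2 + κ * (2 * m + 1) * e1
    refine ⟨a, a', fun Y hY => ?_⟩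
    refine le_trans ?_ (hab Y hY)
    set S2 : ℝ → ℝ := fun r => ∑ i ∈ Finset.range ((m + 1) / 2), a' i * r ^ (-(2 * m : ℝ) + 2 * i) with hS2
    have hS2c : ContinuousOn S2 (Ioi 0) := contsum _ _ _
    have l1 : ∫ r in R..Y, rem (m + 1) (p 0) (y 0) a a' r =
        ∫ r in R..Y, (r ^ (2 * m) * (r * p 0 r - S2 r) ^ 2 + r ^ (2 * m + 2) * (y 0 r - T r) ^ 2) := by
      apply intervalIntegral.integral_congr
      intro r hr
      rw [uIcc_of_le hY] at hr
      have hr0 : 0 < r := lt_of_lt_of_le hR hr.1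
      have e : S2 r = r * ∑ i ∈ Finset.range ((m + 1) / 2), a' i * r ^ (-(2 * ((m + 1 : ℕ) : ℝ) - 1) + 2 * i) := by
        rw [Finset.mul_sum]
        apply Finset.sum_congr rfl
        intro i _
        rw [show -(2 * ((m + 1 : ℕ) : ℝ) - 1) + 2 * i = (-(2 * m : ℝ) + 2 * i) - 1 by push_cast; ring,
          Real.rpow_sub_one hr0.ne']
        field_simp
      simp only [rem]
      rw [e]
      simp only [hT]
      ring
    have l2 : ∫ r in R..Y, rem m (fun r => r * y 0 r + (2 * m + 1) * v 0 r) (fun r => r * p 0 r) a' b' r =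
        ∫ r in R..Y, (r ^ (2 * m) * (r * p 0 r - S2 r) ^ 2 +
          r ^ (2 * m) * (r * (y 0 r - T r) + (2 * m + 1) * V r) ^ 2) := by
      apply intervalIntegral.integral_congr
      intro r hr
      rw [uIcc_of_le hY] at hr
      have hr0 : 0 < r := lt_of_lt_of_le hR hr.1
      simp only [rem]
      rw [hVh r hr0]
      ring
    rw [l1]
    refine le_trans ?_ (le_of_eq l2.symm)
    rw [intervalIntegral.integral_add (ii (by fun_prop) hR hY) (ii (by fun_prop) hR hY),
      intervalIntegral.integral_add (ii (by fun_prop) hR hY) (ii (by fun_prop) hR hY),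
      hardy m hVd hVc hR hY, hVR]
    have hY0 : 0 < Y := lt_of_lt_of_le hR hY
    have : 0 ≤ (2 * m + 1) * Y ^ (2 * m + 1) * V Y ^ 2 := by positivity
    simp only [ne_eq, OfNat.ofNat_ne_zero, not_false_eq_true, zero_pow, mul_zero, sub_zero]
    linarith

end CE

namespace CE
open Set Filter Topology

/-- The abstract conclusion. -/
lemma final_abs {En A : ℝ → ℝ} {I C : ℝ} (hC : ∀ t, En t ≤ C)
    (herr : ∀ ε, 0 < ε → ∃ T, ∀ t, T ≤ |t| → A t ≤ En t + ε)
    (hI : ∀ t₁ t₂, 0 ≤ t₁ → t₂ ≤ 0 → I ≤ A t₁ + A t₂) :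
    max (liminf En atTop) (liminf En atBot) ≥ 1 / 2 * I := by
  by_contra! hlt
  obtain ⟨h1, h2⟩ := max_lt_iff.1 hlt
  obtain ⟨M, hM1, hM2⟩ := exists_between hlt
  obtain ⟨h1, h2⟩ := max_lt_iff.1 hM1
  obtain ⟨T, hT⟩ := herr (I / 2 - M) (by linarith)
  have f1 : ∃ᶠ t in atTop, En t < M := frequently_lt_of_liminf_lt (h := h1)
    (isBoundedUnder_of ⟨C, hC⟩ : IsBoundedUnder (· ≤ ·) atTop En).isCoboundedUnder_flip
  have f2 : ∃ᶠ t in atBot, En t < M := frequently_lt_of_liminf_lt (h := h2)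
    (isBoundedUnder_of ⟨C, hC⟩ : IsBoundedUnder (· ≤ ·) atBot En).isCoboundedUnder_flip
  obtain ⟨t₁, ht₁, hg₁⟩ := (f1.and_eventually (eventually_ge_atTop (max T 0))).exists
  obtain ⟨t₂, ht₂, hg₂⟩ := (f2.and_eventually (eventually_le_atBot (min (-T) 0))).exists
  have a1 : 0 ≤ t₁ := le_trans (le_max_right _ _) hg₁
  have a2 : t₂ ≤ 0 := le_trans hg₂ (min_le_right _ _)
  have b1 := hT t₁ (by rw [abs_of_nonneg a1]; exact le_trans (le_max_left _ _) hg₁)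
  have b2 := hT t₂ (by rw [abs_of_nonpos a2]; linarith [min_le_left (-T) 0])
  have := hI t₁ t₂ a1 a2
  linarith

section FixedTime
variable {U D : ℝ → ℝ} {n : ℕ}

/-- Derivative of `U² r^(n+1)`. -/
lemma W_deriv (hU : ∀ r, 0 < r → HasDerivAt U (D r) r) {r : ℝ} (hr : 0 < r) :
    HasDerivAt (fun r => U r ^ 2 * r ^ (n + 1))
      (2 * (U r * D r * r ^ (n + 1)) + (n + 1) * (U r ^ 2 * r ^ n)) r := by
  refine (((hU r hr).pow 2).mul (hasDerivAt_pow (n + 1) r)).congr_deriv ?_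
  push_cast
  simp
  ring

lemma cross_int (hU : ∀ r, 0 < r → HasDerivAt U (D r) r)
    (hD : ContinuousOn D (Ioi 0)) (hDi : IntegrableOn (fun r => D r ^ 2 * r ^ (n + 2)) (Ioi 0))
    (hUi : IntegrableOn (fun r => U r ^ 2 * r ^ n) (Ioi 0)) :
    IntegrableOn (fun r => U r * D r * r ^ (n + 1)) (Ioi 0) := by
  have hUc : ContinuousOn U (Ioi 0) := fun r hr => (hU r hr).continuousAt.continuousWithinAt
  refine Integrable.mono' (hDi.add hUi) ?_ ?_
  · exact ContinuousOn.aestronglyMeasurable (by fun_prop) measurableSet_Ioi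
  · refine (ae_restrict_iff' measurableSet_Ioi).2 (ae_of_all _ fun r hr => ?_)
    have hr : 0 < r := hr
    simp only [Pi.add_apply, Real.norm_eq_abs]
    have e1 : D r ^ 2 * r ^ (n + 2) + U r ^ 2 * r ^ n = r ^ n * ((D r * r) ^ 2 + U r ^ 2) := by ring
    have e2 : U r * D r * r ^ (n + 1) = r ^ n * (U r * (D r * r)) := by ring
    rw [e1, e2, abs_mul, abs_of_pos (pow_pos hr n)]
    apply mul_le_mul_of_nonneg_left _ (pow_pos hr n).le
    rw [abs_le]
    constructor <;> nlinarith [sq_nonneg (U r + D r * r), sq_nonneg (U r - D r * r), sq_nonneg (U r), sq_nonneg (D r * r)]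

lemma W_tendsto (hU : ∀ r, 0 < r → HasDerivAt U (D r) r)
    (hD : ContinuousOn D (Ioi 0)) (hDi : IntegrableOn (fun r => D r ^ 2 * r ^ (n + 2)) (Ioi 0))
    (hUi : IntegrableOn (fun r => U r ^ 2 * r ^ n) (Ioi 0)) :
    Tendsto (fun r => U r ^ 2 * r ^ (n + 1)) atTop (𝓝 0) := by
  have hi : IntegrableOn (fun r => 2 * (U r * D r * r ^ (n + 1)) + (n + 1) * (U r ^ 2 * r ^ n)) (Ioi 0) :=
    ((cross_int hU hD hDi hUi).const_mul 2).add (hUi.const_mul _)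
  have h := tendsto_limUnder_of_hasDerivAt_of_integrableOn_Ioi (a := 0)
    (f := fun r => U r ^ 2 * r ^ (n + 1)) (fun r hr => W_deriv hU hr) hi
  set L := limUnder atTop (fun r => U r ^ 2 * r ^ (n + 1)) with hL
  have hL0 : 0 ≤ L := by
    apply ge_of_tendsto h
    filter_upwards [eventually_gt_atTop 0] with r hr
    positivity
  rcases hL0.eq_or_lt with h0 | h0
  · rw [← h0] at h; exact h
  exfalso
  have he : ∀ᶠ r in atTop, L / 2 < U r ^ 2 * r ^ (n + 1) := h.eventually_const_lt (by linarith)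
  obtain ⟨X, hX⟩ := (he.and (eventually_gt_atTop 0)).exists_forall_of_atTop
  have hX0 : 0 < X := (hX X le_rfl).2
  apply not_integrableOn_Ioi_inv (a := X)
  have hUi' := (hUi.mono_set (Ioi_subset_Ioi hX0.le)).const_mul (2 / L)
  refine Integrable.mono' hUi' (measurable_inv.aestronglyMeasurable) ?_
  refine (ae_restrict_iff' measurableSet_Ioi).2 (ae_of_all _ fun r hr => ?_)
  have hr : X < r := hr
  obtain ⟨h1, h2⟩ := hX r hr.le
  rw [Real.norm_of_nonneg (by positivity), inv_eq_one_div, div_le_iff₀ h2]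
  have : 2 / L * (L / 2) ≤ 2 / L * (U r ^ 2 * r ^ (n + 1)) :=
    mul_le_mul_of_nonneg_left h1.le (by positivity)
  have e : 2 / L * (L / 2) = 1 := by field_simp
  rw [e] at this
  calc 1 ≤ _ := this
    _ = _ := by ring

lemma A_expand (c a : ℝ) (hca : c ^ 2 - (n + 1) * c = a) {r : ℝ} (hr : 0 < r) :
    (D r + c / r * U r) ^ 2 * r ^ (n + 2) = D r ^ 2 * r ^ (n + 2) + (a * (U r ^ 2 * r ^ n) +
      c * (2 * (U r * D r * r ^ (n + 1)) + (n + 1) * (U r ^ 2 * r ^ n))) := by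
  rw [← hca, pow_add r n 2, pow_add r n 1]
  field_simp
  ring

lemma A_int (hU : ∀ r, 0 < r → HasDerivAt U (D r) r)
    (hD : ContinuousOn D (Ioi 0)) (hDi : IntegrableOn (fun r => D r ^ 2 * r ^ (n + 2)) (Ioi 0))
    (hUi : IntegrableOn (fun r => U r ^ 2 * r ^ n) (Ioi 0)) (c : ℝ) :
    IntegrableOn (fun r => (D r + c / r * U r) ^ 2 * r ^ (n + 2)) (Ioi 0) := by
  refine IntegrableOn.congr_fun (f := fun r => D r ^ 2 * r ^ (n + 2) + ((c ^ 2 - (n + 1) * c) * (U r ^ 2 * r ^ n) +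
      c * (2 * (U r * D r * r ^ (n + 1)) + (n + 1) * (U r ^ 2 * r ^ n)))) ?_ (fun r hr => (A_expand c _ rfl hr).symm) measurableSet_Ioi
  exact hDi.add ((hUi.const_mul _).add ((((cross_int hU hD hDi hUi).const_mul 2).add (hUi.const_mul _)).const_mul c))

lemma A_eq (hU : ∀ r, 0 < r → HasDerivAt U (D r) r)
    (hD : ContinuousOn D (Ioi 0)) (hDi : IntegrableOn (fun r => D r ^ 2 * r ^ (n + 2)) (Ioi 0))
    (hUi : IntegrableOn (fun r => U r ^ 2 * r ^ n) (Ioi 0)) (c a : ℝ) (hca : c ^ 2 - (n + 1) * c = a)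
    {X : ℝ} (hX : 0 < X) :
    ∫ r in Ioi X, (D r + c / r * U r) ^ 2 * r ^ (n + 2) = (∫ r in Ioi X, D r ^ 2 * r ^ (n + 2)) +
      a * (∫ r in Ioi X, U r ^ 2 * r ^ n) - c * (U X ^ 2 * X ^ (n + 1)) := by
  have hs : Ioi X ⊆ Ioi (0:ℝ) := Ioi_subset_Ioi hX.le
  have hc := (cross_int hU hD hDi hUi).mono_set hs
  have hU' := hUi.mono_set hs
  have hD' := hDi.mono_set hs
  have hW : IntegrableOn (fun r => 2 * (U r * D r * r ^ (n + 1)) + (n + 1) * (U r ^ 2 * r ^ n)) (Ioi X) :=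
    (hc.const_mul 2).add (hU'.const_mul _)
  rw [setIntegral_congr_fun measurableSet_Ioi (fun r hr => A_expand (D := D) (U := U) c a hca (hs hr))]
  have hWc := hW.const_mul c
  have hUc := hU'.const_mul a
  have hUW : IntegrableOn (fun r => a * (U r ^ 2 * r ^ n) +
      c * (2 * (U r * D r * r ^ (n + 1)) + (n + 1) * (U r ^ 2 * r ^ n))) (Ioi X) := hUc.add hWc
  rw [integral_add hD' hUW, integral_add hUc hWc, integral_const_mul, integral_const_mul,
    integral_Ioi_of_hasDerivAt_of_tendsto' (f := fun r => U r ^ 2 * r ^ (n + 1)) (m := 0)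
      (fun r hr => W_deriv hU (lt_of_lt_of_le hX hr)) hW (W_tendsto hU hD hDi hUi)]
  ring

lemma err_bound (hU : ∀ r, 0 < r → HasDerivAt U (D r) r)
    (hD : ContinuousOn D (Ioi 0)) (hDi : IntegrableOn (fun r => D r ^ 2 * r ^ (n + 2)) (Ioi 0))
    (hUi : IntegrableOn (fun r => U r ^ 2 * r ^ n) (Ioi 0)) (c a : ℝ) (hca : c ^ 2 - (n + 1) * c = a)
    (ha : 0 < a) {κ : ℝ} (hκ : 0 < κ) (hcκ : c = -κ)
    {X X' : ℝ} (hX : 0 < X) (hXX : X ≤ X') {E e : ℝ}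
    (hE : ∫ r in Ioi X, (D r + c / r * U r) ^ 2 * r ^ (n + 2) ≤ E)
    (he : ∫ r in Ioi X', (D r + c / r * U r) ^ 2 * r ^ (n + 2) ≤ e) {l : ℝ} (hl : 0 < l) :
    ∫ r in Ioi X, (D r + c / r * U r) ^ 2 * r ^ (n + 2) ≤ (∫ r in Ioi X, D r ^ 2 * r ^ (n + 2)) +
      (e + (a + κ / l) * ((X' - X) / X * (E / κ)) + κ * l * E) := by
  have hX' : 0 < X' := lt_of_lt_of_le hX hXX
  have hUc : ContinuousOn U (Ioi 0) := fun r hr => (hU r hr).continuousAt.continuousWithinAt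
  have hs : ∀ {X : ℝ}, 0 < X → Ioi X ⊆ Ioi (0:ℝ) := fun hX => Ioi_subset_Ioi hX.le
  have nn : ∀ {φ : ℝ → ℝ} {k : ℕ} {s : ℝ}, 0 < s → 0 ≤ ∫ r in Ioi s, φ r ^ 2 * r ^ k := by
    intro φ k s hs
    apply setIntegral_nonneg measurableSet_Ioi
    intro r hr
    have : 0 < r := lt_trans hs hr
    positivity
  have hAi := A_int hU hD hDi hUi c
  have eq := fun {s : ℝ} (h : 0 < s) => A_eq hU hD hDi hUi c a hca h
  have hWb : ∀ s, X ≤ s → U s ^ 2 * s ^ (n + 1) ≤ E / κ := by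
    intro s hs'
    have hs0 : 0 < s := lt_of_lt_of_le hX hs'
    have h1 := eq hs0
    have h2 : ∫ r in Ioi s, (D r + c / r * U r) ^ 2 * r ^ (n + 2) ≤ E := by
      refine le_trans (setIntegral_mono_set (hAi.mono_set (hs hX)) ?_ (Ioi_subset_Ioi hs').eventuallyLE) hE
      refine (ae_restrict_iff' measurableSet_Ioi).2 (ae_of_all _ fun r hr => ?_)
      have : 0 < r := lt_trans hX hr
      simp only [Pi.zero_apply]
      positivity
    rw [le_div_iff₀ hκ]
    have h3 := nn (φ := D) (k := n + 2) hs0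
    have h4 := mul_nonneg ha.le (nn (φ := U) (k := n) hs0)
    rw [hcκ] at h1 h2
    linarith
  have hsplit : ∀ {φ : ℝ → ℝ}, IntegrableOn φ (Ioi 0) →
      ∫ r in Ioi X, φ r = (∫ r in X..X', φ r) + ∫ r in Ioi X', φ r := by
    intro φ h
    rw [intervalIntegral.integral_of_le hXX, ← setIntegral_union (Ioc_disjoint_Ioi le_rfl) measurableSet_Ioi
      (h.mono_set (fun x hx => lt_trans hX hx.1)) (h.mono_set (hs hX')), Ioc_union_Ioi_eq_Ioi hXX]
  have q1 := eq hX
  have q2 := eq hX'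
  have hD2 : ∫ r in X..X', D r ^ 2 * r ^ (n + 2) ≤ E := by
    have h1 := hsplit hDi
    have h2 := nn (φ := D) (k := n + 2) hX'
    have h3 := mul_nonneg ha.le (nn (φ := U) (k := n) hX)
    have h4 : 0 ≤ κ * (U X ^ 2 * X ^ (n + 1)) := by positivity
    rw [hcκ] at q1 hE
    linarith
  have hU2 : ∫ r in X..X', U r ^ 2 * r ^ n ≤ (X' - X) / X * (E / κ) := by
    have : ∫ r in X..X', U r ^ 2 * r ^ n ≤ ∫ r in X..X', (1 / X * (E / κ) : ℝ) := by
      apply intervalIntegral.integral_mono_on hXX (ii (by fun_prop) hX hXX) (by simp)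
      intro r hr
      have hr0 : 0 < r := lt_of_lt_of_le hX hr.1
      have h1 := hWb r hr.1
      have h2 : U r ^ 2 * r ^ n * X ≤ U r ^ 2 * r ^ (n + 1) := by
        rw [pow_succ r n, ← mul_assoc]
        exact mul_le_mul_of_nonneg_left hr.1 (by positivity)
      rw [one_div, inv_mul_eq_div, le_div_iff₀ hX]
      linarith
    rw [intervalIntegral.integral_const, smul_eq_mul] at this
    calc _ ≤ _ := this
      _ = _ := by ring
  have hWd := ftc (fun r hr => W_deriv (n := n) hU hr) (by fun_prop) hX hXX
  have hcr : - (∫ r in X..X', (2 * (U r * D r * r ^ (n + 1)) + (n + 1) * (U r ^ 2 * r ^ n))) ≤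
      1 / l * (∫ r in X..X', U r ^ 2 * r ^ n) + l * (∫ r in X..X', D r ^ 2 * r ^ (n + 2)) := by
    rw [← intervalIntegral.integral_neg, ← intervalIntegral.integral_const_mul,
      ← intervalIntegral.integral_const_mul, ← intervalIntegral.integral_add (ii (by fun_prop) hX hXX) (ii (by fun_prop) hX hXX)]
    apply intervalIntegral.integral_mono_on hXX (ii (by fun_prop) hX hXX) (ii (by fun_prop) hX hXX)
    intro r hr
    have hr0 : 0 < r := lt_of_lt_of_le hX hr.1
    have e : 1 / l * (U r ^ 2 * r ^ n) + l * (D r ^ 2 * r ^ (n + 2)) + 2 * (U r * D r * r ^ (n + 1))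
      = 1 / l * r ^ n * (U r + l * D r * r) ^ 2 := by
      rw [pow_add r n 2, pow_add r n 1]; field_simp; ring
    have h1 : 0 ≤ 1 / l * r ^ n * (U r + l * D r * r) ^ 2 := by positivity
    have h2 : 0 ≤ ((n:ℝ) + 1) * (U r ^ 2 * r ^ n) := by positivity
    linarith
  have sU := hsplit hUi
  have h5 := nn (φ := D) (k := n + 2) hX'
  have h6 : a * (∫ r in X..X', U r ^ 2 * r ^ n) ≤ a * ((X' - X) / X * (E / κ)) := mul_le_mul_of_nonneg_left hU2 ha.le
  have h7 : 1 / l * (∫ r in X..X', U r ^ 2 * r ^ n) ≤ 1 / l * ((X' - X) / X * (E / κ)) := mul_le_mul_of_nonneg_left hU2 (by positivity)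
  have h8 : l * (∫ r in X..X', D r ^ 2 * r ^ (n + 2)) ≤ l * E := mul_le_mul_of_nonneg_left hD2 hl.le
  rw [hWd] at hcr
  have h9 : κ * (U X ^ 2 * X ^ (n + 1) - U X' ^ 2 * X' ^ (n + 1)) ≤ κ * (1 / l * ((X' - X) / X * (E / κ)) + l * E) :=
    mul_le_mul_of_nonneg_left (by linarith) hκ.le
  rw [q1, sU]
  have h10 : κ / l = κ * (1 / l) := by ring
  rw [h10]
  rw [hcκ] at q2 he ⊢
  have e1 := q2
  nlinarith [h5, h6, h9, q2, he]

end FixedTime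

end CE

namespace CE
open Set Filter Topology

lemma C1.congr4 {F Ft Fr G Gt Gr} (h : C1 F Ft Fr) (h0 : ∀ t r, 0 < r → G t r = F t r)
    (h1 : ∀ t r, 0 < r → Gt t r = Ft t r)
    (h2 : ∀ t r, 0 < r → Gr t r = Fr t r) : C1 G Gt Gr := by
  have h := h.congr h1 h2
  refine ⟨fun t r hr => ?_, fun t r hr => ?_, h.ct, h.cr⟩
  · have e : (fun s => G s r) = fun s => F s r := by ext s; exact h0 s r hr
    rw [e]; exact h.ht t r hr
  · refine (h.hr t r hr).congr_of_eventuallyEq ?_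
    filter_upwards [eventually_gt_nhds hr] with s hs using h0 t s hs

lemma c1_of {G : ℝ × ℝ → ℝ} (h : ContDiffOn ℝ 1 G HP) :
    C1 (fun t r => G (t, r)) (fun t r => fderiv ℝ G (t, r) (1, 0)) (fun t r => fderiv ℝ G (t, r) (0, 1)) := by
  have hd : ∀ q ∈ HP, HasFDerivAt G (fderiv ℝ G q) q := fun q hq =>
    ((h.differentiableOn (by simp)).differentiableAt (isOpen_HP.mem_nhds hq)).hasFDerivAt
  have hc := h.continuousOn_fderiv_of_isOpen isOpen_HP (by simp)
  refine ⟨?_, ?_, ?_, ?_⟩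
  · intro t r hr
    exact (hd (t, r) hr).comp_hasDerivAt t ((hasDerivAt_id t).prodMk (hasDerivAt_const t r))
  · intro t r hr
    exact (hd (t, r) hr).comp_hasDerivAt r ((hasDerivAt_const r t).prodMk (hasDerivAt_id r))
  · exact hc.clm_apply continuousOn_const
  · exact hc.clm_apply continuousOn_const

lemma c2_of {u : ℝ → ℝ → ℝ}
    (hreg : ContDiffOn ℝ 2 (fun p : ℝ × ℝ => u p.1 p.2) (Set.univ ×ˢ Set.Ioi 0)) :
    ∃ utt utr urr, C1 u (fun t r => deriv (fun s => u s r) t) (fun t r => deriv (u t) r) ∧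
      C1 (fun t r => deriv (fun s => u s r) t) utt utr ∧ C1 (fun t r => deriv (u t) r) utr urr := by
  set G : ℝ × ℝ → ℝ := fun p => u p.1 p.2 with hG
  have hs : (Set.univ ×ˢ Set.Ioi 0 : Set (ℝ × ℝ)) = HP := by ext q; simp [HP]
  rw [hs] at hreg
  have h0 := c1_of (hreg.of_le (by norm_num))
  have hD : ContDiffOn ℝ 1 (fderiv ℝ G) HP := hreg.fderiv_of_isOpen isOpen_HP (by norm_num)
  have h1 := c1_of (hD.clm_apply (contDiffOn_const (c := ((1:ℝ), (0:ℝ)))))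
  have h2 := c1_of (hD.clm_apply (contDiffOn_const (c := ((0:ℝ), (1:ℝ)))))
  have e1 : ∀ t r, 0 < r → deriv (fun s => u s r) t = fderiv ℝ G (t, r) (1, 0) := fun t r hr =>
    (h0.ht t r hr).deriv
  have e2 : ∀ t r, 0 < r → deriv (u t) r = fderiv ℝ G (t, r) (0, 1) := fun t r hr =>
    (h0.hr t r hr).deriv
  refine ⟨_, _, _, h0.congr e1 e2, h1.congr4 e1 (fun _ _ _ => rfl) (fun _ _ _ => rfl),
    h2.congr4 e2 ?_ (fun _ _ _ => rfl)⟩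
  intro t r hr
  have hn : HP ∈ 𝓝 (t, r) := isOpen_HP.mem_nhds hr
  have hdd : DifferentiableAt ℝ (fderiv ℝ G) (t, r) :=
    (hD.differentiableOn (by simp)).differentiableAt hn
  have hsym := (hreg.contDiffAt hn).isSymmSndFDerivAt (by simp)
  rw [fderiv_clm_apply hdd (by fun_prop), fderiv_clm_apply hdd (by fun_prop)]
  simp
  exact hsym _ _

lemma rpow_c1 (c k : ℝ) : C1 (fun _ r => k * r ^ c) (fun _ _ => 0) (fun _ r => k * (c * r ^ (c - 1))) :=
  C1.ofr (fun r hr => (Real.hasDerivAt_rpow_const (Or.inl hr.ne')).const_mul k)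
    (continuousOn_const.mul (continuousOn_const.mul (contpow _)))

lemma sol_of {u ut ur utt utr urr : ℝ → ℝ → ℝ} (h0 : C1 u ut ur) (h1 : C1 ut utt utr) (h2 : C1 ur utr urr)
    (m : ℕ) (c a d : ℝ) (hm : 2 * (m : ℝ) + 2 * c = d) (hca : c ^ 2 - (d - 1) * c = a)
    (hw : ∀ t r, 0 < r → utt t r = urr t r + d / r * ur t r - a / r ^ 2 * u t r) :
    Sol m (fun t r => r ^ c * u t r) (fun t r => r ^ c * ut t r)
      (fun t r => r ^ c * (ur t r + c / r * u t r)) := by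
  have hrc : C1 (fun _ r => r ^ c) (fun _ _ => 0) (fun _ r => (c * r ^ (c - 1))) :=
    C1.ofr (fun r hr => (Real.hasDerivAt_rpow_const (Or.inl hr.ne')))
      ((continuousOn_const.mul (contpow _)))
  have hrd := rpow_c1 (c - 1) c
  have hp : ∀ r : ℝ, 0 < r → r ^ (c - 1) = r ^ c / r := fun r hr => Real.rpow_sub_one hr.ne' c
  have hp2 : ∀ r : ℝ, 0 < r → r ^ (c - 1 - 1) = r ^ c / r / r := fun r hr => by
    rw [Real.rpow_sub_one hr.ne', Real.rpow_sub_one hr.ne']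
  refine ⟨fun t r => r ^ c * utt t r, fun t r => r ^ c * (utr t r + c / r * ut t r),
    fun t r => r ^ c * (urr t r + 2 * c / r * ur t r + (c ^ 2 - c) / r ^ 2 * u t r), ?_, ?_, ?_, ?_⟩
  · refine (hrc.mul h0).congr ?_ ?_
    · intro t r hr; ring
    · intro t r hr; rw [hp r hr]; ring
  · refine (hrc.mul h1).congr ?_ ?_
    · intro t r hr; ring
    · intro t r hr; rw [hp r hr]; ring
  · refine ((hrc.mul h2).add (hrd.mul h0)).congr4 ?_ ?_ ?_
    · intro t r hr; simp only [hp r hr]; ring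
    · intro t r hr; simp only [hp r hr]; ring
    · intro t r hr; simp only [hp r hr, hp2 r hr]; ring
  · intro t r hr
    simp only []
    rw [hw t r hr, ← hca, ← hm]
    field_simp
    ring

end CE

namespace CE
open Set Filter Topology

lemma rem_cont {m : ℕ} {p y : ℝ → ℝ} (hp : ContinuousOn p (Ioi 0)) (hy : ContinuousOn y (Ioi 0)) (a b : ℕ → ℝ) :
    ContinuousOn (fun r => r ^ (2 * m) * (p r - ∑ i ∈ Finset.range (m / 2), b i * r ^ (-(2 * m - 1 : ℝ) + 2 * i)) ^ 2) (Ioi 0) ∧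
    ContinuousOn (fun r => r ^ (2 * m) * (y r - ∑ i ∈ Finset.range ((m + 1) / 2), a i * r ^ (-(2 * m : ℝ) + 2 * i)) ^ 2) (Ioi 0) := by
  have h1 := contsum (m / 2) b (fun i => -(2 * m - 1 : ℝ) + 2 * i)
  have h2 := contsum ((m + 1) / 2) a (fun i => -(2 * m : ℝ) + 2 * i)
  constructor
  · exact (continuousOn_pow _).mul ((hp.sub h1).pow 2)
  · exact (continuousOn_pow _).mul ((hy.sub h2).pow 2)

lemma integral_le_of_bdd {φ : ℝ → ℝ} {X B : ℝ} (hi : IntegrableOn φ (Ioi X))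
    (hb : ∀ Y, X ≤ Y → ∫ r in X..Y, φ r ≤ B) : ∫ r in Ioi X, φ r ≤ B := by
  apply le_of_tendsto (intervalIntegral_tendsto_integral_Ioi X hi tendsto_id)
  filter_upwards [eventually_ge_atTop X] with Y hY using hb Y hY

lemma interval_le_Ioi {φ : ℝ → ℝ} {X Y : ℝ} (hX : 0 < X) (hi : IntegrableOn φ (Ioi X))
    (hn : ∀ r, 0 < r → 0 ≤ φ r) (hXY : X ≤ Y) : ∫ r in X..Y, φ r ≤ ∫ r in Ioi X, φ r := by
  rw [intervalIntegral.integral_of_le hXY]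
  refine setIntegral_mono_set hi ?_ Ioc_subset_Ioi_self.eventuallyLE
  exact (ae_restrict_iff' measurableSet_Ioi).2 (ae_of_all _ fun r hr => hn r (lt_trans hX hr))

theorem core {u ut ur utt utr urr : ℝ → ℝ → ℝ} (h0 : C1 u ut ur) (h1 : C1 ut utt utr) (h2 : C1 ur utr urr)
    (m n : ℕ) (hm1 : 1 ≤ m) (c a κ : ℝ) (ha : 0 < a) (hκ : 0 < κ) (hcκ : c = -κ)
    (hm : 2 * (m : ℝ) + 2 * c = n + 2) (hca : c ^ 2 - (n + 1) * c = a)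
    (hw : ∀ t r, 0 < r → utt t r = urr t r + (n + 2) / r * ur t r - a / r ^ 2 * u t r)
    (hE : ∀ t, IntegrableOn (fun r => (ut t r ^ 2 + ur t r ^ 2 + a * u t r ^ 2 / r ^ 2) * r ^ (n + 2)) (Ioi 0))
    {R : ℝ} (hR : 0 < R) :
    ∃ (A : ℝ → ℝ) (C : ℝ),
      (∀ t, ∫ r in Ioi (|t| + R), (ut t r ^ 2 + ur t r ^ 2) * r ^ (n + 2) ≤ C) ∧
      (∀ ε, 0 < ε → ∃ T, ∀ t, T ≤ |t| →
        A t ≤ (∫ r in Ioi (|t| + R), (ut t r ^ 2 + ur t r ^ 2) * r ^ (n + 2)) + ε) ∧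
      (∀ t₁ t₂, 0 ≤ t₁ → t₂ ≤ 0 → ∃ aa bb : ℕ → ℝ,
        (∫ r in Ioi R, r ^ (2 * m) * (r ^ c * (ur 0 r + c / r * u 0 r) -
            ∑ i ∈ Finset.range ((m + 1) / 2), aa i * r ^ (-(2 * m : ℝ) + 2 * i)) ^ 2) +
        (∫ r in Ioi R, r ^ (2 * m) * (r ^ c * ut 0 r -
            ∑ i ∈ Finset.range (m / 2), bb i * r ^ (-(2 * m - 1 : ℝ) + 2 * i)) ^ 2) ≤ A t₁ + A t₂) := by
  have hsol := sol_of h0 h1 h2 m c a (n + 2) hm (by rw [← hca]; ring) hw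
  have hcd := hsol.contdens
  set v : ℝ → ℝ → ℝ := fun t r => r ^ c * u t r with hv
  set p : ℝ → ℝ → ℝ := fun t r => r ^ c * ut t r with hp
  set y : ℝ → ℝ → ℝ := fun t r => r ^ c * (ur t r + c / r * u t r) with hy
  have hu := fun t => slice h0.cont t
  have hut := fun t => slice h0.ct t
  have hur := fun t => slice h0.cr t
  have hpw : ∀ r : ℝ, 0 < r → r ^ (2 * m) * (r ^ c) ^ 2 = r ^ (n + 2) := by
    intro r hr
    rw [← Real.rpow_natCast, ← Real.rpow_natCast (r ^ c), ← Real.rpow_mul hr.le, ← Real.rpow_add hr,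
      ← Real.rpow_natCast]
    congr 1
    push_cast
    linarith
  have hdens : ∀ t r, 0 < r → dens m p y t r =
      ut t r ^ 2 * r ^ (n + 2) + (ur t r + c / r * u t r) ^ 2 * r ^ (n + 2) := by
    intro t r hr
    rw [← hpw r hr]
    simp only [dens, hp, hy]
    ring
  -- integrability of the pieces
  have part : ∀ (t : ℝ) (φ : ℝ → ℝ), ContinuousOn φ (Ioi 0) → (∀ r, 0 < r → 0 ≤ φ r) →
      (∀ r, 0 < r → φ r ≤ (ut t r ^ 2 + ur t r ^ 2 + a * u t r ^ 2 / r ^ 2) * r ^ (n + 2)) →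
      IntegrableOn φ (Ioi 0) := by
    intro t φ hc hn hle
    refine Integrable.mono' (hE t) (hc.aestronglyMeasurable measurableSet_Ioi) ?_
    refine (ae_restrict_iff' measurableSet_Ioi).2 (ae_of_all _ fun r hr => ?_)
    rw [Real.norm_of_nonneg (hn r hr)]
    exact hle r hr
  have iT : ∀ t, IntegrableOn (fun r => ut t r ^ 2 * r ^ (n + 2)) (Ioi 0) := by
    intro t
    have := hut t
    refine part t _ (by fun_prop) (fun r hr => by positivity) (fun r hr => ?_)
    apply mul_le_mul_of_nonneg_right _ (by positivity)
    have : 0 ≤ a * u t r ^ 2 / r ^ 2 := by positivity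
    nlinarith [sq_nonneg (ur t r)]
  have iD : ∀ t, IntegrableOn (fun r => ur t r ^ 2 * r ^ (n + 2)) (Ioi 0) := by
    intro t
    have := hur t
    refine part t _ (by fun_prop) (fun r hr => by positivity) (fun r hr => ?_)
    apply mul_le_mul_of_nonneg_right _ (by positivity)
    have : 0 ≤ a * u t r ^ 2 / r ^ 2 := by positivity
    nlinarith [sq_nonneg (ut t r)]
  have iU : ∀ t, IntegrableOn (fun r => u t r ^ 2 * r ^ n) (Ioi 0) := by
    intro t
    have := hu t
    have h : IntegrableOn (fun r => a * (u t r ^ 2 * r ^ n)) (Ioi 0) := by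
      refine part t _ (by fun_prop) (fun r hr => by positivity) (fun r hr => ?_)
      have e : a * (u t r ^ 2 * r ^ n) = (a * u t r ^ 2 / r ^ 2) * r ^ (n + 2) := by
        rw [pow_add]; field_simp
      rw [e]
      apply mul_le_mul_of_nonneg_right _ (by positivity)
      nlinarith [sq_nonneg (ut t r), sq_nonneg (ur t r)]
    have h' := h.const_mul a⁻¹
    refine IntegrableOn.congr_fun h' (fun r _ => ?_) measurableSet_Ioi
    field_simp
  have iA := fun t => A_int (fun r hr => h0.hr t r hr) (hur t) (iD t) (iU t) c
  have iDens : ∀ t, IntegrableOn (dens m p y t) (Ioi 0) := fun t =>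
    IntegrableOn.congr_fun ((iT t).add (iA t)) (fun r hr => (hdens t r hr).symm) measurableSet_Ioi
  have sub : ∀ {X : ℝ}, 0 < X → Ioi X ⊆ Ioi (0:ℝ) := fun hX => Ioi_subset_Ioi hX.le
  have hdn : ∀ t r, 0 < r → 0 ≤ dens m p y t r := fun t r _ => dens_nonneg m p y t r
  have posX : ∀ (t : ℝ) {R : ℝ}, 0 < R → 0 < |t| + R := fun t R hR => by positivity
  have dsplit : ∀ t {X : ℝ}, 0 < X → ∫ r in Ioi X, dens m p y t r = (∫ r in Ioi X, ut t r ^ 2 * r ^ (n + 2)) +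
      ∫ r in Ioi X, (ur t r + c / r * u t r) ^ 2 * r ^ (n + 2) := by
    intro t X hX
    rw [← integral_add ((iT t).mono_set (sub hX)) ((iA t).mono_set (sub hX))]
    exact setIntegral_congr_fun measurableSet_Ioi fun r hr => hdens t r (sub hX hr)
  have esplit : ∀ t {X : ℝ}, 0 < X → ∫ r in Ioi X, (ut t r ^ 2 + ur t r ^ 2) * r ^ (n + 2) =
      (∫ r in Ioi X, ut t r ^ 2 * r ^ (n + 2)) + ∫ r in Ioi X, ur t r ^ 2 * r ^ (n + 2) := by
    intro t X hX
    rw [← integral_add ((iT t).mono_set (sub hX)) ((iD t).mono_set (sub hX))]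
    exact setIntegral_congr_fun measurableSet_Ioi fun r hr => by ring
  have nn : ∀ {φ : ℝ → ℝ} {k : ℕ} {s : ℝ}, 0 < s → 0 ≤ ∫ r in Ioi s, φ r ^ 2 * r ^ k := by
    intro φ k s hs
    apply setIntegral_nonneg measurableSet_Ioi
    intro r hr
    have : 0 < r := lt_trans hs hr
    positivity
  -- finite speed on half lines
  have fs : ∀ {R : ℝ}, 0 < R → ∀ t, ∫ r in Ioi (|t| + R), dens m p y t r ≤ ∫ r in Ioi R, dens m p y 0 r := by
    intro R hR t
    apply integral_le_of_bdd ((iDens t).mono_set (sub (posX t hR)))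
    intro Y hY
    refine (finite_speed hsol hR t Y hY).trans (interval_le_Ioi hR ((iDens 0).mono_set (sub hR)) (hdn 0) ?_)
    linarith [abs_nonneg t]
  set C : ℝ := ∫ r in Ioi R, dens m p y 0 r with hC
  have hC0 : 0 ≤ C := setIntegral_nonneg measurableSet_Ioi fun r hr => hdn 0 r (sub hR hr)
  have Ale : ∀ t {R : ℝ}, 0 < R → ∫ r in Ioi (|t| + R), (ur t r + c / r * u t r) ^ 2 * r ^ (n + 2) ≤
      ∫ r in Ioi R, dens m p y 0 r := by
    intro t R hR
    have := fs hR t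
    rw [dsplit t (posX t hR)] at this
    linarith [nn (φ := ut t) (k := n + 2) (posX t hR)]
  -- decay of v
  have hv0 : ∀ t, Tendsto (v t) atTop (𝓝 0) := by
    intro t
    have hW := W_tendsto (fun r hr => h0.hr t r hr) (hur t) (iD t) (iU t)
    have hsq : Tendsto (fun r => v t r ^ 2) atTop (𝓝 0) := by
      refine squeeze_zero' (Eventually.of_forall fun r => sq_nonneg _) ?_ hW
      filter_upwards [eventually_ge_atTop 1] with r hr
      have hr0 : 0 < r := by linarith
      have e : (r ^ c) ^ 2 ≤ r ^ (n + 1) := by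
        rw [← Real.rpow_natCast, ← Real.rpow_mul hr0.le, ← Real.rpow_natCast]
        apply Real.rpow_le_rpow_of_exponent_le hr
        push_cast
        have : (1:ℝ) ≤ m := by exact_mod_cast hm1
        linarith
      simp only [hv]
      rw [mul_pow, mul_comm]
      exact mul_le_mul_of_nonneg_left e (sq_nonneg _)
    have := (Real.continuous_sqrt.tendsto 0).comp hsq
    rw [Real.sqrt_zero] at this
    rw [tendsto_zero_iff_abs_tendsto_zero]
    refine this.congr fun r => ?_
    simp [Real.sqrt_sq_eq_abs]
  refine ⟨fun t => ∫ r in Ioi (|t| + R), dens m p y t r, C, ?_, ?_, ?_⟩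
  · intro t
    have hX := posX t hR
    have h3 := fs hR t
    rw [dsplit t hX, A_eq (fun r hr => h0.hr t r hr) (hur t) (iD t) (iU t) c a hca hX] at h3
    rw [esplit t hX]
    have h4 := mul_nonneg ha.le (nn (φ := u t) (k := n) hX)
    have h5 : 0 ≤ κ * (u t (|t| + R) ^ 2 * (|t| + R) ^ (n + 1)) := by positivity
    rw [hcκ] at h3
    linarith
  · intro ε hε
    -- choose R'
    have htail : Tendsto (fun X => ∫ r in Ioi X, dens m p y 0 r) atTop (𝓝 0) := by
      have h3 := intervalIntegral_tendsto_integral_Ioi R ((iDens 0).mono_set (sub hR)) tendsto_id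
      have h4 : Tendsto (fun X => C - ∫ r in R..X, dens m p y 0 r) atTop (𝓝 (C - C)) :=
        tendsto_const_nhds.sub h3
      rw [sub_self] at h4
      refine h4.congr' ?_
      filter_upwards [eventually_ge_atTop R] with X hX
      rw [hC, intervalIntegral.integral_of_le hX, ← Ioc_union_Ioi_eq_Ioi hX,
        setIntegral_union (Ioc_disjoint_Ioi le_rfl) measurableSet_Ioi
          ((iDens 0).mono_set (fun x hx => lt_trans hR hx.1)) ((iDens 0).mono_set (sub (lt_of_lt_of_le hR hX)))]
      ring
    obtain ⟨R', hR'1, hR'2⟩ := ((htail.eventually_lt_const (show (0:ℝ) < ε / 3 by linarith)).and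
      (eventually_ge_atTop R)).exists
    have hR'0 : 0 < R' := lt_of_lt_of_le hR hR'2
    set l : ℝ := ε / (3 * (κ * (C + 1))) with hl
    have hl0 : 0 < l := by positivity
    have hlC : κ * l * C ≤ ε / 3 := by
      have e : κ * l * (C + 1) = ε / 3 := by
        rw [hl]; field_simp
      have : κ * l * C ≤ κ * l * (C + 1) := mul_le_mul_of_nonneg_left (by linarith) (by positivity)
      linarith
    set M : ℝ := (a + κ / l) * ((R' - R) * (C / κ)) with hM
    have hM0 : 0 ≤ M := by
      have : 0 ≤ R' - R := by linarith
      positivity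
    refine ⟨3 * M / ε, fun t ht => ?_⟩
    have hX := posX t hR
    have hb := err_bound (fun r hr => h0.hr t r hr) (hur t) (iD t) (iU t) c a hca ha hκ hcκ hX
      (X' := |t| + R') (by linarith) (Ale t hR) (Ale t hR'0) hl0
    have hMle : (a + κ / l) * ((|t| + R' - (|t| + R)) / (|t| + R) * (C / κ)) ≤ ε / 3 := by
      have e : (a + κ / l) * ((|t| + R' - (|t| + R)) / (|t| + R) * (C / κ)) = M / (|t| + R) := by
        rw [hM]; ring
      rw [e, div_le_iff₀ hX]
      rw [div_le_iff₀ hε] at ht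
      nlinarith
    simp only []
    rw [dsplit t hX, esplit t hX]
    rw [← hC] at hb
    linarith
  · intro t₁ t₂ ht₁ ht₂
    have kb : ∀ t Y, |t| + R ≤ Y → ∫ r in (|t| + R)..Y, dens m p y t r ≤ ∫ r in Ioi (|t| + R), dens m p y t r :=
      fun t Y hY => interval_le_Ioi (posX t hR) ((iDens t).mono_set (sub (posX t hR))) (hdn t) hY
    obtain ⟨aa, bb, hab⟩ := key m v p y R C hR hsol (fun _ => hv0)
      (fun t Y hY => (kb t Y hY).trans (fs hR t)) t₁ t₂ _ _ ht₁ ht₂ (kb t₁) (kb t₂)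
    refine ⟨aa, bb, ?_⟩
    obtain ⟨c1, c2⟩ := rem_cont (m := m) (slice hsol.contp 0) (slice hsol.conty 0) aa bb
    have n1 : ∀ (φ : ℝ → ℝ) (r : ℝ), 0 < r → 0 ≤ r ^ (2 * m) * φ r ^ 2 := fun φ r hr => by positivity
    have hremeq : rem m (p 0) (y 0) aa bb = fun r => r ^ (2 * m) * (p 0 r - ∑ i ∈ Finset.range (m / 2), bb i * r ^ (-(2 * m - 1 : ℝ) + 2 * i)) ^ 2 + r ^ (2 * m) * (y 0 r - ∑ i ∈ Finset.range ((m + 1) / 2), aa i * r ^ (-(2 * m : ℝ) + 2 * i)) ^ 2 := by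
      ext r; simp only [rem]; ring
    have hrc : ContinuousOn (rem m (p 0) (y 0) aa bb) (Ioi 0) := by rw [hremeq]; exact c1.add c2
    have hrn : ∀ r, 0 < r → 0 ≤ rem m (p 0) (y 0) aa bb r := by
      intro r hr; rw [hremeq]; positivity
    have hri := integrableOn_of_bdd hrc hrn hR hab
    have hrle := integral_le_of_bdd hri hab
    have i1 : IntegrableOn (fun r => r ^ (2 * m) * (p 0 r - ∑ i ∈ Finset.range (m / 2), bb i * r ^ (-(2 * m - 1 : ℝ) + 2 * i)) ^ 2) (Ioi R) := by
      refine Integrable.mono' hri ((c1.mono (sub hR)).aestronglyMeasurable measurableSet_Ioi) ?_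
      refine (ae_restrict_iff' measurableSet_Ioi).2 (ae_of_all _ fun r hr => ?_)
      have hr0 : 0 < r := sub hR hr
      rw [Real.norm_of_nonneg (by positivity), hremeq]
      exact le_add_of_nonneg_right (by positivity)
    have i2 : IntegrableOn (fun r => r ^ (2 * m) * (y 0 r - ∑ i ∈ Finset.range ((m + 1) / 2), aa i * r ^ (-(2 * m : ℝ) + 2 * i)) ^ 2) (Ioi R) := by
      refine Integrable.mono' hri ((c2.mono (sub hR)).aestronglyMeasurable measurableSet_Ioi) ?_
      refine (ae_restrict_iff' measurableSet_Ioi).2 (ae_of_all _ fun r hr => ?_)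
      have hr0 : 0 < r := sub hR hr
      rw [Real.norm_of_nonneg (by positivity), hremeq]
      exact le_add_of_nonneg_left (by positivity)
    rw [hremeq, integral_add i1 i2, add_comm] at hrle
    exact hrle

end CE

/-- Exterior energy (channel of energy) lower bound for radial solutions of the
free wave equation with inverse-square potential: the asymptotic exterior
energy in at least one time direction dominates half the squared distance of
the data to the plane `P(R)` spanned by the explicit powers `r^{α+2i-2}`. -/
theorem channel_of_energy_linear
    (N : ℕ) (hN : 3 ≤ N) (a : ℝ) (ha : 0 < a)
    (β c α : ℝ)
    (hβ : β = Real.sqrt (1 + 4 * a / ((N : ℝ) - 2) ^ 2))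
    (hc : c = ((N : ℝ) - 2) * (1 - β) / 2)
    (hα : α = -(((N : ℝ) - 2) * (1 + β)) / 2)
    (ν : ℕ) (hνodd : Odd ν) (hνpos : 0 < ν) (hνβ : ((N : ℝ) - 2) * β = (ν : ℝ))
    (k₁ k₂ : ℕ) (hk₁ : k₁ = (ν + 2) / 4) (hk₂ : k₂ = (ν + 4) / 4)
    (R : ℝ) (hR : 0 < R)
    (u : ℝ → ℝ → ℝ)
    (hreg : ContDiffOn ℝ 2 (fun p : ℝ × ℝ => u p.1 p.2) (Set.univ ×ˢ Set.Ioi 0))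
    (hwave : ∀ t : ℝ, ∀ r : ℝ, 0 < r →
      deriv (fun s => deriv (fun s' => u s' r) s) t
        = deriv (deriv (u t)) r + (((N : ℝ) - 1) / r) * deriv (u t) r
            - (a / r ^ 2) * u t r)
    (hE : ∀ t : ℝ, IntegrableOn
      (fun r => ((deriv (fun s => u s r) t) ^ 2 + (deriv (u t) r) ^ 2
          + a * (u t r) ^ 2 / r ^ 2) * r ^ ((N : ℝ) - 1)) (Set.Ioi 0))
    (f g : ℝ → ℝ) (hf : f = u 0) (hg : ∀ r, g r = deriv (fun s => u s r) 0) :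
    max
      (Filter.liminf (fun t => ∫ r in Set.Ioi (|t| + R),
          ((deriv (fun s => u s r) t) ^ 2 + (deriv (u t) r) ^ 2) * r ^ ((N : ℝ) - 1))
        Filter.atTop)
      (Filter.liminf (fun t => ∫ r in Set.Ioi (|t| + R),
          ((deriv (fun s => u s r) t) ^ 2 + (deriv (u t) r) ^ 2) * r ^ ((N : ℝ) - 1))
        Filter.atBot)
    ≥ (1 / 2) * ⨅ pq : (Fin k₂ → ℝ) × (Fin k₁ → ℝ),
        ((∫ r in Set.Ioi R,
            |deriv (fun s => f s - ∑ i : Fin k₂, pq.1 i * s ^ (α + 2 * ((i : ℕ) : ℝ))) r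
              + (c / r) * (f r - ∑ i : Fin k₂, pq.1 i * r ^ (α + 2 * ((i : ℕ) : ℝ)))| ^ 2
            * r ^ ((N : ℝ) - 1))
        + (∫ r in Set.Ioi R,
            |g r - ∑ j : Fin k₁, pq.2 j * r ^ (α + 2 * ((j : ℕ) : ℝ))| ^ 2
            * r ^ ((N : ℝ) - 1))) := by
  obtain ⟨n, rfl⟩ : ∃ n, N = n + 3 := ⟨N - 3, by omega⟩
  obtain ⟨j, hj⟩ := hνodd
  obtain ⟨m, hm⟩ : ∃ m, m = j + 1 := ⟨_, rfl⟩
  have hνm : (ν : ℝ) = 2 * m - 1 := by rw [hj, hm]; push_cast; ring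
  have hn1 : (0 : ℝ) < (n : ℝ) + 1 := by positivity
  have hNc : (((n + 3 : ℕ) : ℝ) - 2) = n + 1 := by push_cast; ring
  rw [hNc] at hβ hc hα hνβ
  have hβ2 : β ^ 2 = 1 + 4 * a / ((n : ℝ) + 1) ^ 2 := by
    rw [hβ, Real.sq_sqrt (by positivity)]
  have hβ1 : 1 < β := by
    rw [hβ]
    apply Real.lt_sqrt_of_sq_lt
    have : 0 < 4 * a / ((n : ℝ) + 1) ^ 2 := by positivity
    linarith
  have hcneg : c < 0 := by
    rw [hc]
    nlinarith
  have hca : c ^ 2 - ((n : ℝ) + 1) * c = a := by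
    have e : ((n : ℝ) + 1) ^ 2 * β ^ 2 = ((n : ℝ) + 1) ^ 2 + 4 * a := by
      rw [hβ2]; field_simp
    rw [hc]
    linear_combination e / 4
  have hcν : 2 * c = n + 1 - ν := by rw [hc, ← hνβ]; ring
  have hαν : c + α = -(ν : ℝ) := by rw [hc, hα, ← hνβ]; ring
  have hpow : ∀ r : ℝ, r ^ (((n + 3 : ℕ) : ℝ) - 1) = r ^ (n + 2) := by
    intro r
    rw [← Real.rpow_natCast]; congr 1; push_cast; ring
  simp only [hpow] at hE ⊢
  obtain ⟨utt, utr, urr, h0, h1, h2⟩ := CE.c2_of hreg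
  obtain ⟨A, C, hAC, herr, hab⟩ := CE.core h0 h1 h2 m n (by omega) c a (-c) ha (by linarith) (by ring)
    (by linarith) hca (by
      intro t r hr
      have h3 := hwave t r hr
      rw [(h1.ht t r hr).deriv] at h3
      have h4 : deriv (deriv (u t)) r = urr t r := (h2.hr t r hr).deriv
      rw [h4] at h3
      rw [h3]
      push_cast
      ring) hE hR
  refine CE.final_abs (A := A) hAC herr ?_
  intro t₁ t₂ ht₁ ht₂
  obtain ⟨aa, bb, hle⟩ := hab t₁ t₂ ht₁ ht₂
  refine le_trans (le_trans (ciInf_le ⟨0, ?_⟩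
    ((fun i : Fin k₂ => aa i / (2 * (i : ℕ) - ν)), (fun i : Fin k₁ => bb i))) (le_of_eq ?_)) hle
  · rintro _ ⟨pq, rfl⟩
    apply add_nonneg <;> apply setIntegral_nonneg measurableSet_Ioi <;> intro r hr
    · have : 0 < r := lt_trans hR hr
      positivity
    · have : 0 < r := lt_trans hR hr
      positivity
  have hk₁' : m / 2 = k₁ := by omega
  have hk₂' : (m + 1) / 2 = k₂ := by omega
  have hpw : ∀ r : ℝ, 0 < r → r ^ (2 * m) * (r ^ c) ^ 2 = r ^ (n + 2) := by
    intro r hr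
    rw [← Real.rpow_natCast, ← Real.rpow_natCast (r ^ c), ← Real.rpow_mul hr.le, ← Real.rpow_add hr,
      ← Real.rpow_natCast]
    congr 1
    push_cast
    linarith
  rw [hk₁', hk₂']
  congr 1
  · apply setIntegral_congr_fun measurableSet_Ioi
    intro r hr
    have hr0 : 0 < r := lt_trans hR hr
    have hd : HasDerivAt (fun s => f s - ∑ i : Fin k₂, aa i / (2 * ((i : ℕ) : ℝ) - ν) * s ^ (α + 2 * ((i : ℕ) : ℝ)))
        (deriv (u 0) r - ∑ i : Fin k₂, aa i / (2 * ((i : ℕ) : ℝ) - ν) *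
          ((α + 2 * ((i : ℕ) : ℝ)) * r ^ (α + 2 * ((i : ℕ) : ℝ) - 1))) r := by
      rw [hf]
      refine (h0.hr 0 r hr0).sub (HasDerivAt.fun_sum fun i _ => ?_)
      exact (Real.hasDerivAt_rpow_const (Or.inl hr0.ne')).const_mul _
    simp only []
    rw [hd.deriv, hf, sq_abs, ← hpw r hr0, Finset.sum_range]
    have e : r ^ c * (deriv (u 0) r - ∑ i : Fin k₂, aa i / (2 * ((i : ℕ) : ℝ) - ν) *
          ((α + 2 * ((i : ℕ) : ℝ)) * r ^ (α + 2 * ((i : ℕ) : ℝ) - 1)) +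
        c / r * (u 0 r - ∑ i : Fin k₂, aa i / (2 * ((i : ℕ) : ℝ) - ν) * r ^ (α + 2 * ((i : ℕ) : ℝ)))) =
        r ^ c * (deriv (u 0) r + c / r * u 0 r) -
          ∑ i : Fin k₂, aa i * r ^ (-(2 * (m : ℝ)) + 2 * ((i : ℕ) : ℝ)) := by
      have e2 : ∑ i : Fin k₂, aa i * r ^ (-(2 * (m : ℝ)) + 2 * ((i : ℕ) : ℝ)) =
          r ^ c * ((∑ i : Fin k₂, aa i / (2 * ((i : ℕ) : ℝ) - ν) *
          ((α + 2 * ((i : ℕ) : ℝ)) * r ^ (α + 2 * ((i : ℕ) : ℝ) - 1))) +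
          c / r * ∑ i : Fin k₂, aa i / (2 * ((i : ℕ) : ℝ) - ν) * r ^ (α + 2 * ((i : ℕ) : ℝ))) := by
        rw [Finset.mul_sum, ← Finset.sum_add_distrib, Finset.mul_sum]
        apply Finset.sum_congr rfl
        intro i _
        have hne : (2 * ((i : ℕ) : ℝ) - ν) ≠ 0 := by
          have : (2 * ((i : ℕ) : ℤ) - ν) ≠ 0 := by omega
          exact_mod_cast this
        rw [show -(2 * (m : ℝ)) + 2 * ((i : ℕ) : ℝ) = c + (α + 2 * ((i : ℕ) : ℝ)) - 1 by linarith,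
          Real.rpow_sub_one hr0.ne', Real.rpow_add hr0, Real.rpow_sub_one hr0.ne']
        have hν' : (ν : ℝ) = -(c + α) := by linarith
        rw [hν'] at hne ⊢
        have hne2 : 2 * ((i : ℕ) : ℝ) + (c + α) ≠ 0 := by rw [sub_neg_eq_add] at hne; exact hne
        rw [sub_neg_eq_add]
        field_simp
        ring
      rw [e2]; ring
    rw [← e]
    ring
  · apply setIntegral_congr_fun measurableSet_Ioi
    intro r hr
    have hr0 : 0 < r := lt_trans hR hr
    simp only []
    rw [hg, sq_abs, ← hpw r hr0, Finset.sum_range]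
    have e2 : ∑ i : Fin k₁, bb i * r ^ (-(2 * (m : ℝ) - 1) + 2 * ((i : ℕ) : ℝ)) =
        r ^ c * ∑ i : Fin k₁, bb i * r ^ (α + 2 * ((i : ℕ) : ℝ)) := by
      rw [Finset.mul_sum]
      apply Finset.sum_congr rfl
      intro i _
      rw [show -(2 * (m : ℝ) - 1) + 2 * ((i : ℕ) : ℝ) = c + (α + 2 * ((i : ℕ) : ℝ)) by linarith,
        Real.rpow_add hr0]
      ring
    rw [e2]
    ring
end

section
/- Let N ≥ 3 be an integer, a > 0, β = √(1 + 4a/(N−2)²), and let W_a and ΛW_a be as defined. Then both of the following integrals converge absolutely and: ∫_{ℝ^N} ΛW_a(x) · W_a(x)^{4/(N−2)} · |x|^{−(β+1)(N−2)/2} dx = ( (N−2)²β / (2(N+2)) ) ∫_{ℝ^N} W_a(x)^{(N+2)/(N−2)} |x|^{−(β+1)(N−2)/2} dx, and ∫_{ℝ^N} ΛW_a(x) · W_a(x)^{4/(N−2)} · |x|^{(β−1)(N−2)/2} dx = − ( (N−2)²β / (2(N+2)) ) ∫_{ℝ^N} W_a(x)^{(N+2)/(N−2)} |x|^{(β−1)(N−2)/2}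 dx. -/
open MeasureTheory

lemma aux_u (b q : ℝ) (hb : 0 < b) (hq : 0 < q) :
    IntegrableOn (fun r : ℝ => b * r ^ (b - 1) / (1 + r ^ b) ^ 2 * (r ^ b / (1 + r ^ b)) ^ q)
      (Set.Ioi 0) ∧
    ∫ r in Set.Ioi (0:ℝ), b * r ^ (b - 1) / (1 + r ^ b) ^ 2 * (r ^ b / (1 + r ^ b)) ^ q
      = 1 / (q + 1) := by
  have hc : ContinuousWithinAt (fun r : ℝ => (1 / (q + 1)) * (r ^ b / (1 + r ^ b)) ^ (q + 1))
      (Set.Ici 0) 0 := by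
    apply ContinuousAt.continuousWithinAt
    have h1 : ContinuousAt (fun r : ℝ => r ^ b) 0 :=
      Real.continuousAt_rpow_const _ _ (Or.inr hb.le)
    refine ContinuousAt.mul continuousAt_const ?_
    refine ContinuousAt.rpow_const ?_ (Or.inr (by linarith))
    refine h1.div (continuousAt_const.add h1) ?_
    simp [Real.zero_rpow hb.ne']
  have hd : ∀ r ∈ Set.Ioi (0:ℝ), HasDerivAt
      (fun r : ℝ => (1 / (q + 1)) * (r ^ b / (1 + r ^ b)) ^ (q + 1))
      (b * r ^ (b - 1) / (1 + r ^ b) ^ 2 * (r ^ b / (1 + r ^ b)) ^ q) r := by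
    intro r hr
    have hr : 0 < r := hr
    have hs : 0 < r ^ b := Real.rpow_pos_of_pos hr b
    have h1 : HasDerivAt (fun r : ℝ => r ^ b) (b * r ^ (b - 1)) r :=
      Real.hasDerivAt_rpow_const (Or.inl hr.ne')
    have h2 := h1.div (h1.const_add 1) (by positivity)
    have h3 := (h2.rpow_const (p := q + 1) (Or.inl (by simp only [Pi.div_apply]; positivity))).const_mul (1 / (q + 1))
    refine h3.congr_deriv ?_
    have : q + 1 ≠ 0 := by positivity
    simp only [Pi.div_apply, add_sub_cancel_right]
    field_simp
    ring
  have ht : Filter.Tendsto (fun r : ℝ => (1 / (q + 1)) * (r ^ b / (1 + r ^ b)) ^ (q + 1))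
      Filter.atTop (nhds (1 / (q + 1))) := by
    have h0 : Filter.Tendsto (fun r : ℝ => 1 - (1 + r ^ b)⁻¹) Filter.atTop (nhds (1 - 0)) :=
      tendsto_const_nhds.sub (tendsto_inv_atTop_zero.comp
        (Filter.tendsto_atTop_add_const_left _ 1 (tendsto_rpow_atTop hb)))
    have h1 : Filter.Tendsto (fun r : ℝ => r ^ b / (1 + r ^ b)) Filter.atTop (nhds 1) := by
      rw [sub_zero] at h0
      refine h0.congr' ?_
      filter_upwards [Filter.eventually_gt_atTop 0] with r hr
      have hs : 0 < r ^ b := Real.rpow_pos_of_pos hr b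
      field_simp
      ring
    have h2 := (h1.rpow_const (p := q + 1) (Or.inl one_ne_zero)).const_mul (1 / (q + 1))
    simpa using h2
  have hp : ∀ r ∈ Set.Ioi (0:ℝ),
      0 ≤ b * r ^ (b - 1) / (1 + r ^ b) ^ 2 * (r ^ b / (1 + r ^ b)) ^ q := by
    intro r hr
    have hr : 0 < r := hr
    positivity
  refine ⟨integrableOn_Ioi_deriv_of_nonneg hc hd hp ht, ?_⟩
  rw [integral_Ioi_of_hasDerivAt_of_nonneg hc hd hp ht]
  simp [Real.zero_rpow hb.ne', Real.zero_rpow (by linarith : q + 1 ≠ 0)]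

lemma aux_v (b q : ℝ) (hb : 0 < b) (hq : 0 < q) :
    IntegrableOn (fun r : ℝ => b * r ^ (b - 1) / (1 + r ^ b) ^ 2 * (1 / (1 + r ^ b)) ^ q)
      (Set.Ioi 0) ∧
    ∫ r in Set.Ioi (0:ℝ), b * r ^ (b - 1) / (1 + r ^ b) ^ 2 * (1 / (1 + r ^ b)) ^ q
      = 1 / (q + 1) := by
  have hc : ContinuousWithinAt (fun r : ℝ => -(1 / (q + 1)) * (1 / (1 + r ^ b)) ^ (q + 1))
      (Set.Ici 0) 0 := by
    apply ContinuousAt.continuousWithinAt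
    have h1 : ContinuousAt (fun r : ℝ => r ^ b) 0 :=
      Real.continuousAt_rpow_const _ _ (Or.inr hb.le)
    refine ContinuousAt.mul continuousAt_const ?_
    refine ContinuousAt.rpow_const ?_ (Or.inr (by linarith))
    refine continuousAt_const.div (continuousAt_const.add h1) ?_
    simp [Real.zero_rpow hb.ne']
  have hd : ∀ r ∈ Set.Ioi (0:ℝ), HasDerivAt
      (fun r : ℝ => -(1 / (q + 1)) * (1 / (1 + r ^ b)) ^ (q + 1))
      (b * r ^ (b - 1) / (1 + r ^ b) ^ 2 * (1 / (1 + r ^ b)) ^ q) r := by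
    intro r hr
    have hr : 0 < r := hr
    have hs : 0 < r ^ b := Real.rpow_pos_of_pos hr b
    have h1 : HasDerivAt (fun r : ℝ => r ^ b) (b * r ^ (b - 1)) r :=
      Real.hasDerivAt_rpow_const (Or.inl hr.ne')
    have h2 := (hasDerivAt_const r (1:ℝ)).fun_div (h1.const_add 1) (by positivity)
    have h3 := (h2.rpow_const (p := q + 1) (Or.inl (by positivity))).const_mul (-(1 / (q + 1)))
    refine h3.congr_deriv ?_
    have : q + 1 ≠ 0 := by positivity
    simp only [add_sub_cancel_right]
    field_simp
    ring
  have ht : Filter.Tendsto (fun r : ℝ => -(1 / (q + 1)) * (1 / (1 + r ^ b)) ^ (q + 1))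
      Filter.atTop (nhds 0) := by
    have h1 : Filter.Tendsto (fun r : ℝ => 1 / (1 + r ^ b)) Filter.atTop (nhds 0) := by
      simp only [one_div]
      exact (tendsto_inv_atTop_zero.comp
        (Filter.tendsto_atTop_add_const_left _ 1 (tendsto_rpow_atTop hb)))
    have h2 := (h1.rpow_const (p := q + 1) (Or.inr (by linarith))).const_mul (-(1 / (q + 1)))
    simpa [Real.zero_rpow (by linarith : q + 1 ≠ 0)] using h2
  have hp : ∀ r ∈ Set.Ioi (0:ℝ),
      0 ≤ b * r ^ (b - 1) / (1 + r ^ b) ^ 2 * (1 / (1 + r ^ b)) ^ q := by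
    intro r hr
    have hr : 0 < r := hr
    positivity
  refine ⟨integrableOn_Ioi_deriv_of_nonneg hc hd hp ht, ?_⟩
  rw [integral_Ioi_of_hasDerivAt_of_nonneg hc hd hp ht]
  simp [Real.zero_rpow hb.ne']

/-- explicit power of the profile -/
lemma aux_pow (C β m q r : ℝ) (hC : 0 < C) (hr : 0 < r) :
    (C * (r ^ (β - 1) / (1 + r ^ (2 * β))) ^ m) ^ q =
      C ^ q * (r ^ ((β - 1) * (m * q)) * (1 + r ^ (2 * β)) ^ (-(m * q))) := by
  have hs : 0 < r ^ (2 * β) := Real.rpow_pos_of_pos hr _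
  rw [Real.mul_rpow hC.le (by positivity), ← Real.rpow_mul (by positivity),
    Real.div_rpow (by positivity) (by positivity), ← Real.rpow_mul hr.le,
    Real.rpow_neg (by positivity), div_eq_mul_inv]

lemma aux_deriv (C β m r : ℝ) (hC : 0 < C) (hr : 0 < r) (W : ℝ → ℝ)
    (hW : ∀ r, W r = C * (r ^ (β - 1) / (1 + r ^ (2 * β))) ^ m) :
    m * W r + r * deriv W r = m * β * (2 * (1 / (1 + r ^ (2 * β))) - 1) * W r := by
  have hs : 0 < r ^ (2 * β) := Real.rpow_pos_of_pos hr _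
  have hg : 0 < r ^ (β - 1) := Real.rpow_pos_of_pos hr _
  have h1 : HasDerivAt (fun r : ℝ => r ^ (2 * β)) (2 * β * r ^ (2 * β - 1)) r :=
    Real.hasDerivAt_rpow_const (Or.inl hr.ne')
  have h2 : HasDerivAt (fun r : ℝ => r ^ (β - 1)) ((β - 1) * r ^ (β - 1 - 1)) r :=
    Real.hasDerivAt_rpow_const (Or.inl hr.ne')
  have h3 := ((h2.fun_div (h1.const_add 1) (by positivity)).rpow_const (p := m)
    (Or.inl (by positivity))).const_mul C
  have hWf : W = fun r => C * (r ^ (β - 1) / (1 + r ^ (2 * β))) ^ m := funext hW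
  rw [hWf, h3.deriv]
  simp only
  have hX : 0 < r ^ (β - 1) / (1 + r ^ (2 * β)) := by positivity
  rw [Real.rpow_sub_one hX.ne' m, Real.rpow_sub_one hr.ne' (2 * β),
    Real.rpow_sub_one hr.ne' (β - 1)]
  generalize (r ^ (β - 1) / (1 + r ^ (2 * β))) ^ m = X
  field_simp
  ring



/-- Weighted integral identities for `ΛW_a` against powers of `|x|`, computing
the leading interaction between well-separated solitons. -/
theorem weighted_integral_identities
    (N : ℕ) (hN : 3 ≤ N) (a : ℝ) (ha : 0 < a)
    (β : ℝ) (hβ : β = Real.sqrt (1 + 4 * a / ((N : ℝ) - 2) ^ 2))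
    (W ΛW : ℝ → ℝ)
    (hW : ∀ r : ℝ, W r =
      ((N : ℝ) * ((N : ℝ) - 2) * β ^ 2) ^ (((N : ℝ) - 2) / 4) *
        (r ^ (β - 1) / (1 + r ^ (2 * β))) ^ (((N : ℝ) - 2) / 2))
    (hΛW : ∀ r : ℝ, ΛW r = ((N : ℝ) - 2) / 2 * W r + r * deriv W r) :
    (Integrable fun x : EuclideanSpace ℝ (Fin N) =>
      ΛW ‖x‖ * W ‖x‖ ^ ((4 : ℝ) / ((N : ℝ) - 2)) *
        ‖x‖ ^ (-((β + 1) * ((N : ℝ) - 2) / 2))) ∧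
    (Integrable fun x : EuclideanSpace ℝ (Fin N) =>
      ΛW ‖x‖ * W ‖x‖ ^ ((4 : ℝ) / ((N : ℝ) - 2)) *
        ‖x‖ ^ ((β - 1) * ((N : ℝ) - 2) / 2)) ∧
    (∫ x : EuclideanSpace ℝ (Fin N),
        ΛW ‖x‖ * W ‖x‖ ^ ((4 : ℝ) / ((N : ℝ) - 2)) *
          ‖x‖ ^ (-((β + 1) * ((N : ℝ) - 2) / 2))
      = ((N : ℝ) - 2) ^ 2 * β / (2 * ((N : ℝ) + 2)) *
        ∫ x : EuclideanSpace ℝ (Fin N),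
          W ‖x‖ ^ (((N : ℝ) + 2) / ((N : ℝ) - 2)) *
            ‖x‖ ^ (-((β + 1) * ((N : ℝ) - 2) / 2))) ∧
    (∫ x : EuclideanSpace ℝ (Fin N),
        ΛW ‖x‖ * W ‖x‖ ^ ((4 : ℝ) / ((N : ℝ) - 2)) *
          ‖x‖ ^ ((β - 1) * ((N : ℝ) - 2) / 2)
      = -(((N : ℝ) - 2) ^ 2 * β / (2 * ((N : ℝ) + 2))) *
        ∫ x : EuclideanSpace ℝ (Fin N),
          W ‖x‖ ^ (((N : ℝ) + 2) / ((N : ℝ) - 2)) *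
            ‖x‖ ^ ((β - 1) * ((N : ℝ) - 2) / 2)) := by
  have hN' : (3:ℝ) ≤ N := by exact_mod_cast hN
  obtain ⟨m, hm⟩ : ∃ m : ℝ, m = ((N : ℝ) - 2) / 2 := ⟨_, rfl⟩
  have hNm : (N : ℝ) = 2 * m + 2 := by linarith
  have hm0 : 0 < m := by linarith
  have hβ0 : 0 < β := by rw [hβ]; positivity
  have hC : 0 < ((N : ℝ) * ((N : ℝ) - 2) * β ^ 2) ^ (((N : ℝ) - 2) / 4) := by
    apply Real.rpow_pos_of_pos
    have : 0 < (N : ℝ) - 2 := by linarith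
    positivity
  generalize ((N : ℝ) * ((N : ℝ) - 2) * β ^ 2) ^ (((N : ℝ) - 2) / 4) = C at hC hW
  rw [← hm] at hW
  have e1 : ((N : ℝ) + 2) / ((N : ℝ) - 2) = (m + 2) / m := by
    rw [hNm, show 2 * m + 2 - 2 = 2 * m by ring]; field_simp; ring
  have e2 : 4 / ((N : ℝ) - 2) = 2 / m := by
    rw [hNm, show 2 * m + 2 - 2 = 2 * m by ring]; field_simp; ring
  have e3 : -((β + 1) * ((N : ℝ) - 2) / 2) = -((β + 1) * m) := by rw [hm]; ring
  have e4 : (β - 1) * ((N : ℝ) - 2) / 2 = (β - 1) * m := by rw [hm]; ring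
  have e5 : ((N : ℝ) - 2) ^ 2 * β / (2 * ((N : ℝ) + 2)) = m ^ 2 * β / (m + 2) := by
    rw [hNm]; field_simp; ring
  rw [e1, e2, e3, e4, e5]
  have hpm : m * ((m + 2) / m) = m + 2 := by field_simp
  have hpow : ∀ r : ℝ, 0 < r → r ^ (N - 1) = r ^ (2 * m + 1) := by
    intro r hr
    rw [← Real.rpow_natCast, Nat.cast_sub (by omega), hNm]
    congr 1
    push_cast; ring
  have hWpos : ∀ r : ℝ, 0 < r → 0 < W r := by
    intro r hr
    rw [hW]; positivity
  have hL : ∀ r : ℝ, 0 < r → ΛW r * W r ^ (2 / m) =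
      m * β * (2 * (1 / (1 + r ^ (2 * β))) - 1) * W r ^ ((m + 2) / m) := by
    intro r hr
    rw [hΛW, ← hm, aux_deriv C β m r hC hr W hW, mul_assoc]
    congr 1
    rw [show (m + 2) / m = 1 + 2 / m by field_simp, Real.rpow_add (hWpos r hr), Real.rpow_one]
  -- pointwise radial forms
  have hA1 : ∀ r : ℝ, 0 < r → r ^ (N - 1) * (W r ^ ((m + 2) / m) * r ^ (-((β + 1) * m))) =
      C ^ ((m + 2) / m) / (2 * β) *
        (2 * β * r ^ (2 * β - 1) / (1 + r ^ (2 * β)) ^ 2 * (1 / (1 + r ^ (2 * β))) ^ m) := by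
    intro r hr
    have hs : 0 < r ^ (2 * β) := Real.rpow_pos_of_pos hr _
    have hD : 0 < 1 + r ^ (2 * β) := by positivity
    rw [hpow r hr, hW, aux_pow C β m _ r hC hr, hpm, Real.div_rpow zero_le_one hD.le,
      Real.one_rpow, neg_add, Real.rpow_add hD, Real.rpow_neg hD.le m, Real.rpow_neg hD.le 2,
      Real.rpow_two]
    have : r ^ (2 * β - 1) = r ^ (2 * m + 1) * r ^ ((β - 1) * (m + 2)) * r ^ (-((β + 1) * m)) := by
      rw [← Real.rpow_add hr, ← Real.rpow_add hr]; congr 1; ring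
    rw [this]
    field_simp
  have hA2 : ∀ r : ℝ, 0 < r → r ^ (N - 1) * (W r ^ ((m + 2) / m) * r ^ ((β - 1) * m)) =
      C ^ ((m + 2) / m) / (2 * β) *
        (2 * β * r ^ (2 * β - 1) / (1 + r ^ (2 * β)) ^ 2 *
          (r ^ (2 * β) / (1 + r ^ (2 * β))) ^ m) := by
    intro r hr
    have hs : 0 < r ^ (2 * β) := Real.rpow_pos_of_pos hr _
    have hD : 0 < 1 + r ^ (2 * β) := by positivity
    rw [hpow r hr, hW, aux_pow C β m _ r hC hr, hpm, Real.div_rpow hs.le hD.le,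
      ← Real.rpow_mul hr.le, neg_add, Real.rpow_add hD, Real.rpow_neg hD.le m,
      Real.rpow_neg hD.le 2, Real.rpow_two]
    have : r ^ (2 * β - 1) * r ^ (2 * β * m) =
        r ^ (2 * m + 1) * r ^ ((β - 1) * (m + 2)) * r ^ ((β - 1) * m) := by
      rw [← Real.rpow_add hr, ← Real.rpow_add hr, ← Real.rpow_add hr]; congr 1; ring
    generalize r ^ (2 * β * m) = x1 at *
    generalize r ^ (2 * β - 1) = x2 at *
    generalize r ^ (2 * m + 1) = x3 at *
    generalize r ^ ((β - 1) * (m + 2)) = x4 at *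
    generalize r ^ ((β - 1) * m) = x5 at *
    field_simp
    linear_combination (-1) * this
  have hB1 : ∀ r : ℝ, 0 < r →
      r ^ (N - 1) * (ΛW r * W r ^ (2 / m) * r ^ (-((β + 1) * m))) =
      m * β * (C ^ ((m + 2) / m) / (2 * β)) *
        (2 * (2 * β * r ^ (2 * β - 1) / (1 + r ^ (2 * β)) ^ 2 *
            (1 / (1 + r ^ (2 * β))) ^ (m + 1)) -
          2 * β * r ^ (2 * β - 1) / (1 + r ^ (2 * β)) ^ 2 * (1 / (1 + r ^ (2 * β))) ^ m) := by
    intro r hr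
    have hs : 0 < r ^ (2 * β) := Real.rpow_pos_of_pos hr _
    rw [hL r hr, Real.rpow_add_one (by positivity)]
    linear_combination (m * β * (2 * (1 / (1 + r ^ (2 * β))) - 1)) * hA1 r hr
  have hB2 : ∀ r : ℝ, 0 < r →
      r ^ (N - 1) * (ΛW r * W r ^ (2 / m) * r ^ ((β - 1) * m)) =
      m * β * (C ^ ((m + 2) / m) / (2 * β)) *
        (2 * β * r ^ (2 * β - 1) / (1 + r ^ (2 * β)) ^ 2 *
            (r ^ (2 * β) / (1 + r ^ (2 * β))) ^ m -
          2 * (2 * β * r ^ (2 * β - 1) / (1 + r ^ (2 * β)) ^ 2 *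
            (r ^ (2 * β) / (1 + r ^ (2 * β))) ^ (m + 1))) := by
    intro r hr
    have hs : 0 < r ^ (2 * β) := Real.rpow_pos_of_pos hr _
    have hv : 1 / (1 + r ^ (2 * β)) = 1 - r ^ (2 * β) / (1 + r ^ (2 * β)) := by
      field_simp; ring
    rw [hL r hr, Real.rpow_add_one (by positivity), hv]
    linear_combination (m * β * (2 * (1 - r ^ (2 * β) / (1 + r ^ (2 * β))) - 1)) * hA2 r hr
  have hb : 0 < 2 * β := by positivity
  obtain ⟨iu0, vu0⟩ := aux_u (2 * β) m hb hm0
  obtain ⟨iu1, vu1⟩ := aux_u (2 * β) (m + 1) hb (by linarith)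
  obtain ⟨iv0, vv0⟩ := aux_v (2 * β) m hb hm0
  obtain ⟨iv1, vv1⟩ := aux_v (2 * β) (m + 1) hb (by linarith)
  have : NeZero N := ⟨by omega⟩
  have hdim : Module.finrank ℝ (EuclideanSpace ℝ (Fin N)) = N := finrank_euclideanSpace_fin
  refine ⟨?_, ?_, ?_, ?_⟩
  · refine (integrable_fun_norm_addHaar (volume : Measure (EuclideanSpace ℝ (Fin N)))
      (f := fun r => ΛW r * W r ^ (2 / m) * r ^ (-((β + 1) * m)))).2 ?_
    rw [hdim]
    simp only [smul_eq_mul]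
    refine (integrableOn_congr_fun (fun r hr => hB1 r hr) measurableSet_Ioi).2 ?_
    exact ((iv1.const_mul 2).sub iv0).const_mul _
  · refine (integrable_fun_norm_addHaar (volume : Measure (EuclideanSpace ℝ (Fin N)))
      (f := fun r => ΛW r * W r ^ (2 / m) * r ^ ((β - 1) * m))).2 ?_
    rw [hdim]
    simp only [smul_eq_mul]
    refine (integrableOn_congr_fun (fun r hr => hB2 r hr) measurableSet_Ioi).2 ?_
    exact (iu0.sub (iu1.const_mul 2)).const_mul _
  · rw [integral_fun_norm_addHaar (volume : Measure (EuclideanSpace ℝ (Fin N)))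
      (fun r => ΛW r * W r ^ (2 / m) * r ^ (-((β + 1) * m))),
      integral_fun_norm_addHaar (volume : Measure (EuclideanSpace ℝ (Fin N)))
      (fun r => W r ^ ((m + 2) / m) * r ^ (-((β + 1) * m))), hdim]
    simp only [smul_eq_mul]
    rw [setIntegral_congr_fun measurableSet_Ioi (fun r hr => hB1 r hr),
      setIntegral_congr_fun measurableSet_Ioi (fun r hr => hA1 r hr),
      integral_const_mul, integral_const_mul, integral_sub (iv1.const_mul 2) iv0,
      integral_const_mul, vv0, vv1]
    simp only [nsmul_eq_mul]
    field_simp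
    ring
  · rw [integral_fun_norm_addHaar (volume : Measure (EuclideanSpace ℝ (Fin N)))
      (fun r => ΛW r * W r ^ (2 / m) * r ^ ((β - 1) * m)),
      integral_fun_norm_addHaar (volume : Measure (EuclideanSpace ℝ (Fin N)))
      (fun r => W r ^ ((m + 2) / m) * r ^ ((β - 1) * m)), hdim]
    simp only [smul_eq_mul]
    rw [setIntegral_congr_fun measurableSet_Ioi (fun r hr => hB2 r hr),
      setIntegral_congr_fun measurableSet_Ioi (fun r hr => hA2 r hr),
      integral_const_mul, integral_const_mul, integral_sub iu0 (iu1.const_mul 2),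
      integral_const_mul, vu0, vu1]
    simp only [nsmul_eq_mul]
    field_simp
    ring
end
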